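/- arXiv:1110.4654 — 4 statements merged into one kernel-verified Lean document; each statement's English description precedes it below -/
import Mathlib

section
/- Let k > 1 be an integer and let λ : ℕ≥1 → ℤ be a finitely supported sequence. Then the following are equivalent. (i) For every cusp form f of weight 2k for SL₂(ℤ) (i.e. f : ℍ → ℂ holomorphic with f((aτ+b)/(cτ+d)) = (cτ+d)^{2k} f(τ) for all [[a,b],[c,d]] ∈ SL₂(ℤ) and with an absolutely convergent Fourier expansion f(τ) = Σ_{m≥1} a_m e(mτ)), one has Σ_{m≥1} λ_m a_m = 0 (a finite sum). (ii) There exists a weakly holomorphic modular form g of weight 2−2k for SL₂(ℤ), i.e. g : ℍ → ℂ holomorphic with g((aτ+b)/(cτ+d)) = (cτ+d)^{2−2k} g(τ) for all [[a,b],[c,d]] ∈ SL₂(ℤ), admitting a Fourier expansion g(τ) = Σ_{n≥−N} c(n) e(nτ) for some N ∈ ℕ (absolutely convergent on ℍ), such that c(−m) = λ_m for every m ≥ 1. -/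
noncomputable section

open Complex Real

/-- The upper half-plane, as a subset of `ℂ`. -/
def UHP : Set ℂ := {z : ℂ | 0 < z.im}

/-- `e(z) = exp(2πiz)`. -/
def e (z : ℂ) : ℂ := Complex.exp (2 * (π : ℂ) * I * z)

section

lemma core_int (h : ℂ → ℂ) (hd : DifferentiableOn ℂ h {z : ℂ | 0 < z.im})
    (hS : ∀ z : ℂ, 0 < z.im → h (-z⁻¹) = z ^ 2 * h z)
    (hT : ∀ z : ℂ, 0 < z.im → h (z + 1) = h z) :
    ∫ u in (0:ℝ)..1, h (u + ((√3 / 2 : ℝ) : ℂ) * I) = 0 := by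
  have h3 : (√3) ^ 2 = 3 := Real.sq_sqrt (by norm_num)
  have h3p : 0 < √3 := by positivity
  have h31 : 1.7 < √3 := by nlinarith
  have h32 : √3 < 1.8 := by nlinarith
  have hball : ∀ z : ℂ, z ∈ Metric.ball (2 * I) 2 ↔ z.re ^ 2 + z.im ^ 2 < 4 * z.im := by
    intro z
    rw [Metric.mem_ball, Complex.dist_eq, ← sq_lt_sq₀ (norm_nonneg _) (by norm_num),
      ← Complex.normSq_eq_norm_sq, Complex.normSq_apply]
    simp
    constructor <;> intro h <;> nlinarith
  have hbpos : ∀ z ∈ Metric.ball (2 * I) 2, 0 < z.im := by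
    intro z hz
    rw [hball] at hz
    nlinarith [sq_nonneg z.re, sq_nonneg z.im]
  obtain ⟨H, hH⟩ := (hd.mono hbpos).isExactOn_ball
  set ρ : ℂ := ⟨-1/2, √3/2⟩ with hρ
  set V : Set ℂ := Metric.ball (2 * I) 2 ∩ {z | 1/4 < z.im} with hV
  have hVo : IsOpen V := Metric.isOpen_ball.inter (isOpen_lt continuous_const Complex.continuous_im)
  have hVc : Convex ℝ V := (convex_ball _ _).inter (convex_halfSpace_im_gt _)
  have hinv : ∀ z ∈ V, -z⁻¹ ∈ Metric.ball (2 * I) 2 := by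
    rintro z ⟨hz, hz'⟩
    have hp := hbpos z hz
    have hn : 0 < normSq z := by
      rw [Complex.normSq_pos]; rintro rfl; simp at hp
    rw [hball] at hz ⊢
    simp only [Set.mem_ofPred_eq] at hz'
    have e1 : (-z⁻¹).re = - z.re / normSq z := by simp [Complex.inv_re, neg_div]
    have e2 : (-z⁻¹).im = z.im / normSq z := by simp [Complex.inv_im, neg_div]
    rw [e1, e2]
    have : (-z.re / normSq z) ^ 2 + (z.im / normSq z) ^ 2 = 1 / normSq z := by
      field_simp
      rw [Complex.normSq_apply]; ring
    rw [this, ← mul_div_assoc]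
    exact div_lt_div_of_pos_right (by linarith) hn
  have hD : ∀ z ∈ V, HasDerivAt (fun z => H (-z⁻¹) - H z) 0 z := by
    intro z hz
    have hp := hbpos z hz.1
    have hz0 : z ≠ 0 := by rintro rfl; simp at hp
    have h1 := (hH _ (hinv z hz)).comp z ((hasDerivAt_inv hz0).neg)
    have h2 := h1.sub (hH z hz.1)
    convert! h2 using 1
    rw [hS z hp]
    field_simp
    ring
  have hconst : ∀ x ∈ V, ∀ y ∈ V, H (-x⁻¹) - H x = H (-y⁻¹) - H y := by
    intro x hx y hy
    exact hVo.is_const_of_deriv_eq_zero hVc.isPreconnected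
      (fun z hz => (hD z hz).differentiableAt.differentiableWithinAt)
      (fun z hz => (hD z hz).deriv) hx hy
  have hI : I ∈ V := by
    refine ⟨(hball _).2 ?_, ?_⟩ <;> norm_num
  have hρV : ρ ∈ V := by
    refine ⟨(hball _).2 ?_, ?_⟩
    · simp only [hρ]; nlinarith
    · simp only [hρ, Set.mem_ofPred_eq]; linarith
  have hρ1 : -ρ⁻¹ = ρ + 1 := by
    have hn : normSq ρ = 1 := by
      rw [Complex.normSq_apply]; simp only [hρ]; nlinarith
    apply Complex.ext
    · simp [Complex.inv_re, hn]; simp [hρ]; norm_num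
    · simp [Complex.inv_im, hn]
  have hkey : H (ρ + 1) = H ρ := by
    have := hconst ρ hρV I hI
    simp only [Complex.inv_I, neg_neg, sub_self] at this
    rw [← hρ1]; exact sub_eq_zero.1 this
  have hseg : ∀ u ∈ Set.uIcc (0:ℝ) 1, ρ + (u:ℂ) ∈ Metric.ball (2 * I) 2 := by
    intro u hu
    rw [Set.uIcc_of_le zero_le_one] at hu
    rw [hball]
    simp [hρ]
    nlinarith [hu.1, hu.2]
  have hder : ∀ u ∈ Set.uIcc (0:ℝ) 1, HasDerivAt (fun u : ℝ => H (ρ + (u:ℂ))) (h (ρ + u)) u := by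
    intro u hu
    have h1 : HasDerivAt (fun w : ℂ => H (ρ + w)) (h (ρ + u)) (u : ℂ) := by
      have := hH _ (hseg u hu)
      exact this.comp_const_add ρ (u:ℂ)
    exact h1.comp_ofReal
  have hint : IntervalIntegrable (fun u : ℝ => h (ρ + u)) MeasureTheory.volume 0 1 := by
    apply ContinuousOn.intervalIntegrable
    apply ContinuousOn.comp (t := {z : ℂ | 0 < z.im}) hd.continuousOn (by fun_prop)
    intro u hu
    exact hbpos _ (hseg u hu)
  have hF := intervalIntegral.integral_eq_sub_of_hasDerivAt hder hint
  simp only [ofReal_one, ofReal_zero, add_zero, hkey, sub_self] at hF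
  have hper : Function.Periodic (fun u : ℝ => h (u + ((√3 / 2 : ℝ) : ℂ) * I)) 1 := by
    intro u
    have := hT (u + ((√3 / 2 : ℝ) : ℂ) * I) (by simp)
    simp only
    rw [← this]; push_cast; ring_nf
  have h4 := hper.intervalIntegral_add_eq 0 (-1/2)
  rw [zero_add] at h4
  rw [h4, ← hF]
  have := intervalIntegral.integral_comp_add_right (a := 0) (b := 1) (fun u : ℝ => h (u + ((√3 / 2 : ℝ) : ℂ) * I)) (-1/2)
  rw [zero_add, add_comm 1] at this
  rw [← this]
  congr 1
  ext u
  congr 1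
  apply Complex.ext <;> simp [hρ]
  ring

open UpperHalfPlane hiding I
open scoped MatrixGroups Manifold
open ModularForm

local notation "𝕢" => Function.Periodic.qParam

structure Nice (F : ℍ → ℂ) : Prop where
  per : Function.Periodic (F ∘ ofComplex) ((1 : ℝ) : ℂ)
  hol : MDiff F
  bdd : IsBoundedAtImInfty F

lemma Nice.an {F : ℍ → ℂ} (h : Nice F) : AnalyticAt ℂ (cuspFunction 1 F) 0 :=
  analyticAt_cuspFunction_zero one_pos h.per h.hol h.bdd

lemma Nice.mul {F G : ℍ → ℂ} (hF : Nice F) (hG : Nice G) : Nice (F * G) where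
  per := by
    intro z
    have h1 := hF.per z
    have h2 := hG.per z
    simp only [Function.comp_apply, Pi.mul_apply] at *
    rw [h1, h2]
  hol := hF.hol.mul hG.hol
  bdd := hF.bdd.mul hG.bdd

lemma Nice.one : Nice 1 where
  per := by intro z; simp
  hol := by
    rw [UpperHalfPlane.mdifferentiable_iff]
    exact differentiableOn_const (1 : ℂ)
  bdd := by
    exact Filter.const_boundedAtFilter _ (1 : ℂ)

lemma Nice.pow {F : ℍ → ℂ} (hF : Nice F) (n : ℕ) : Nice (F ^ n) := by
  induction n with
  | zero => simpa using Nice.one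
  | succ n ih => rw [pow_succ]; exact ih.mul hF

lemma Nice.qpow {F : ℍ → ℂ} (hF : Nice F) (n : ℕ) :
    qExpansion 1 (F ^ n) = qExpansion 1 F ^ n := by
  induction n with
  | zero => simpa using qExpansion_one 1
  | succ n ih => rw [pow_succ, pow_succ, qExpansion_mul (hF.pow n).an hF.an, ih]

lemma nice_form {k : ℤ} {A : Type*} [FunLike A ℍ ℂ] [ModularFormClass A 𝒮ℒ k] (f : A) :
    Nice f := by
  have : Fact (IsCusp OnePoint.infty 𝒮ℒ) :=
    ⟨Subgroup.isCusp_of_mem_strictPeriods one_pos one_mem_strictPeriods_SL⟩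
  exact ⟨SlashInvariantFormClass.periodic_comp_ofComplex f one_mem_strictPeriods_SL,
    ModularFormClass.holo f, ModularFormClass.bdd_at_infty f⟩

lemma per_of (F : ℍ → ℂ) (h : ∀ τ : ℍ, F ((1 : ℝ) +ᵥ τ) = F τ) :
    Function.Periodic (F ∘ ofComplex) ((1 : ℝ) : ℂ) := by
  intro w
  by_cases! hw : 0 < w.im
  · have : 0 < (w + ((1 : ℝ) : ℂ)).im := by simpa using hw
    simp only [Function.comp_apply, ofComplex_apply_of_im_pos this, ofComplex_apply_of_im_pos hw]
    rw [← h ⟨w, hw⟩]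
    congr 1
    ext
    simp [add_comm]
  · have : (w + ((1 : ℝ) : ℂ)).im ≤ 0 := by simpa using hw
    simp only [Function.comp_apply, ofComplex_apply_of_im_nonpos this,
      ofComplex_apply_of_im_nonpos hw]

lemma nice_of_hasSum (F : ℍ → ℂ) (c : ℕ → ℂ) (hol : MDiff F)
    (hT : ∀ τ : ℍ, F ((1 : ℝ) +ᵥ τ) = F τ)
    (hs : ∀ τ : ℍ, HasSum (fun m ↦ c m • 𝕢 1 τ ^ m) (F τ)) :
    Nice F ∧ ∀ m, (qExpansion 1 F).coeff m = c m := by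
  have hn : Nice F := ⟨per_of F hT, hol, isBoundedAtImInfty_of_hasSum_qExpansion (h := 1) one_pos hs⟩
  refine ⟨hn, fun m => ?_⟩
  have h1 := (hasFPowerSeriesOnBall_cuspFunction one_pos hn.an hs).hasFPowerSeriesAt
  have h2 : HasFPowerSeriesAt (cuspFunction 1 F)
      (.ofScalars ℂ fun m => (qExpansion 1 F).coeff m) 0 := by
    simpa [qExpansion_coeff, div_eq_mul_inv, mul_comm] using hn.an.hasFPowerSeriesAt
  have h3 := congr_arg (FormalMultilinearSeries.coeff · m) (h2.eq_formalMultilinearSeries h1)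
  simpa [FormalMultilinearSeries.coeff_ofScalars] using h3

lemma qper (z : ℂ) : 𝕢 1 (z + ((1 : ℝ) : ℂ)) = 𝕢 1 z := by
  simp only [Function.Periodic.qParam, ofReal_one, div_one, mul_add, mul_one, Complex.exp_add,
    Complex.exp_two_pi_mul_I]

lemma q_shift (τ : ℍ) : 𝕢 1 (((1 : ℝ) +ᵥ τ : ℍ) : ℂ) = 𝕢 1 τ := by
  rw [UpperHalfPlane.coe_vadd, add_comm]
  exact qper (τ : ℂ)

lemma nice_q : Nice (fun τ : ℍ => 𝕢 1 τ) ∧ qExpansion 1 (fun τ : ℍ => 𝕢 1 τ) = PowerSeries.X := by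
  have := nice_of_hasSum (fun τ : ℍ => 𝕢 1 τ) (fun m => if m = 1 then 1 else 0) ?_ q_shift ?_
  · refine ⟨this.1, ?_⟩
    ext m
    rw [this.2, PowerSeries.coeff_X]
  · rw [UpperHalfPlane.mdifferentiable_iff]
    have : DifferentiableOn ℂ (𝕢 1) {z | 0 < z.im} :=
      (Function.Periodic.differentiable_qParam).differentiableOn
    refine this.congr ?_
    intro z hz
    simp [ofComplex_apply_of_im_pos hz]
  · intro τ
    have := hasSum_single (f := fun m : ℕ => (if m = 1 then (1:ℂ) else 0) • 𝕢 1 (τ : ℂ) ^ m) 1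
      (by intro b hb; simp [hb])
    simpa using this

def uq : ℍ → ℂ := fun τ => 𝕢 1 τ / discriminant τ

lemma nice_uq : Nice uq where
  per := by
    apply per_of
    intro τ
    have h1 := nice_form CuspForm.discriminant
    have h2 := h1.per τ
    simp only [Function.comp_apply, ofComplex_apply] at h2
    have h3 : ofComplex ((τ : ℂ) + ((1:ℝ):ℂ)) = (1 : ℝ) +ᵥ τ := by
      rw [← ofComplex_apply ((1 : ℝ) +ᵥ τ), UpperHalfPlane.coe_vadd, add_comm]
    rw [h3] at h2
    have h4 : discriminant ((1 : ℝ) +ᵥ τ) = discriminant τ := h2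
    simp only [uq, q_shift, h4]
  hol := nice_q.1.hol.div CuspForm.discriminant.holo' discriminant_ne_zero
  bdd := by
    rw [IsBoundedAtImInfty, Filter.BoundedAtFilter]
    refine (Asymptotics.div_isBoundedUnder_of_isBigO ?_).isBigO_one ℝ
    refine Asymptotics.IsBigO.trans ?_ exp_isBigO_discriminant
    refine Asymptotics.IsBigO.of_bound 1 (Filter.Eventually.of_forall fun τ => ?_)
    simp [Function.Periodic.qParam, Complex.norm_exp]

lemma uq_mul : qExpansion 1 uq * qExpansion 1 discriminant = PowerSeries.X := by
  have h1 := nice_form CuspForm.discriminant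
  rw [CuspForm.coe_discriminant] at h1
  rw [← qExpansion_mul nice_uq.an h1.an, ← nice_q.2]
  congr 1
  ext τ
  simp [uq, discriminant_ne_zero]

lemma pairing (F G : ℍ → ℂ) (hF : Nice F) (hG : Nice G) (N : ℕ)
    (hS : ∀ τ : ℍ, F (ModularGroup.S • τ) * G (ModularGroup.S • τ) /
        𝕢 1 ((ModularGroup.S • τ : ℍ) : ℂ) ^ N = (τ : ℂ) ^ 2 * (F τ * G τ / 𝕢 1 τ ^ N)) :
    ∑ p ∈ Finset.HasAntidiagonal.antidiagonal N,
      (qExpansion 1 F).coeff p.1 * (qExpansion 1 G).coeff p.2 = 0 := by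
  have hFG := hF.mul hG
  rw [← PowerSeries.coeff_mul, ← qExpansion_mul hF.an hG.an,
    qExpansion_coeff_eq_intervalIntegral one_pos hFG.per hFG.hol hFG.bdd N
      (t := √3 / 2) (by positivity)]
  have hd : DifferentiableOn ℂ (fun z => ((F * G) ∘ ofComplex) z / 𝕢 1 z ^ N)
      {z : ℂ | 0 < z.im} := by
    refine (UpperHalfPlane.mdifferentiable_iff.1 hFG.hol).div ?_ ?_
    · exact (Function.Periodic.differentiable_qParam.pow N).differentiableOn
    · intro z _
      exact pow_ne_zero _ (Function.Periodic.qParam_ne_zero _)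
  have := core_int (fun z => ((F * G) ∘ ofComplex) z / 𝕢 1 z ^ N) hd ?_ ?_
  · simp only [div_one, one_mul, ofReal_one]
    convert! this using 2
    ext u
    have hp : 0 < ((u : ℂ) + ((√3/2 : ℝ) : ℂ) * I).im := by simp
    simp only [Function.comp_apply]
    rw [ofComplex_apply_of_im_pos hp, one_div, ← div_eq_inv_mul]
    simp
  · intro z hz
    have := hS ⟨z, hz⟩
    rw [UpperHalfPlane.modular_S_smul] at this
    have hz' : 0 < (-z⁻¹).im := by
      have := (⟨z, hz⟩ : ℍ).im_inv_neg_coe_pos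
      simpa [inv_neg] using this
    simp only [Function.comp_apply, ofComplex_apply_of_im_pos hz',
      ofComplex_apply_of_im_pos hz, Pi.mul_apply]
    simpa [inv_neg] using this
  · intro z hz
    have h1 := hFG.per z
    have h2 := qper z
    simp only [ofReal_one] at h1 h2
    simp only [h1, h2]

lemma form_eqn {k : ℤ} {A : Type*} [FunLike A ℍ ℂ] [SlashInvariantFormClass A 𝒮ℒ k] (f : A)
    (γ : SL(2, ℤ)) (τ : ℍ) : f (γ • τ) = (denom γ τ) ^ k * f τ :=
  SlashInvariantForm.slash_action_eqn' f (⟨γ, rfl⟩ : _ ∈ 𝒮ℒ) τ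

lemma orth (K N : ℕ) (hN : K ≤ N) (f : CuspForm 𝒮ℒ ((2 * K : ℕ) : ℤ))
    (h : ModularForm 𝒮ℒ ((12 * N + 2 - 2 * K : ℕ) : ℤ)) :
    ∑ i : Fin N, (qExpansion 1 (h * uq ^ N)).coeff (N - 1 - i) *
      (qExpansion 1 f).coeff (i + 1) = 0 := by
  have hp := pairing f (h * uq ^ N) (nice_form f) ((nice_form h).mul (nice_uq.pow N)) N ?_
  · rw [Finset.Nat.sum_antidiagonal_eq_sum_range_succ
      (fun i j => (qExpansion 1 f).coeff i * (qExpansion 1 (h * uq ^ N)).coeff j),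
      Finset.sum_range_succ', CuspFormClass.qExpansion_coeff_zero f one_pos
      one_mem_strictPeriods_SL, zero_mul, add_zero, Finset.sum_range] at hp
    rw [← hp]
    refine Finset.sum_congr rfl fun i _ => ?_
    rw [mul_comm, show N - (i + 1 : ℕ) = N - 1 - i by omega]
  · intro τ
    have h1 := form_eqn f ModularGroup.S τ
    have h2 := form_eqn h ModularGroup.S τ
    have h3 := form_eqn CuspForm.discriminant ModularGroup.S τ
    rw [ModularGroup.denom_S] at h1 h2 h3
    rw [CuspForm.coe_discriminant] at h3
    have hd := discriminant_ne_zero τ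
    have hq := Function.Periodic.qParam_ne_zero (h := 1) (τ : ℂ)
    have hq' := Function.Periodic.qParam_ne_zero (h := 1) ((ModularGroup.S • τ : ℍ) : ℂ)
    have hτ := τ.ne_zero
    simp only [Pi.mul_apply, Pi.pow_apply, uq]
    rw [h1, h2, h3]
    rw [zpow_natCast, zpow_natCast, show (12 : ℤ) = ((12 : ℕ) : ℤ) from rfl, zpow_natCast]
    have hw : (τ : ℂ) ^ (2 * K) * (τ : ℂ) ^ (12 * N + 2 - 2 * K) =
        (τ : ℂ) ^ 2 * ((τ : ℂ) ^ 12) ^ N := by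
      rw [← pow_add, ← pow_mul, ← pow_add]; congr 1; omega
    generalize (τ : ℂ) ^ (2 * K) = A at *
    generalize (τ : ℂ) ^ (12 * N + 2 - 2 * K) = B at *
    have : ((τ : ℂ) ^ 12) ^ N ≠ 0 := pow_ne_zero _ (pow_ne_zero _ hτ)
    have hd' : discriminant τ ^ N ≠ 0 := pow_ne_zero _ hd
    simp only [div_pow, mul_pow]
    field_simp
    linear_combination (f τ * h τ) * hw

lemma dims (K N : ℕ) (hK : 2 ≤ K) (hN : K ≤ N) :
    Module.finrank ℂ (ModularForm 𝒮ℒ ((12 * N + 2 - 2 * K : ℕ) : ℤ)) +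
      Module.finrank ℂ (CuspForm 𝒮ℒ ((2 * K : ℕ) : ℤ)) = N := by
  have fdC : FiniteDimensional ℂ (CuspForm 𝒮ℒ ((2 * K : ℕ) : ℤ)) :=
    CuspForm.discriminantEquiv.symm.finiteDimensional
  have h1 := dimension_level_one (12 * N + 2 - 2 * K) ⟨6 * N + 1 - K, by omega⟩
  have h2 := dimension_level_one (2 * K) ⟨K, by omega⟩
  rw [rank_eq_one_add_rank_cuspForm (by omega) ⟨K, by omega⟩] at h2
  rw [← Module.finrank_eq_rank] at h1 h2
  have h1' : Module.finrank ℂ (ModularForm 𝒮ℒ ((12 * N + 2 - 2 * K : ℕ) : ℤ)) =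
      if 12 * N + 2 - 2 * K ≡ 2 [MOD 12] then (12 * N + 2 - 2 * K) / 12
        else (12 * N + 2 - 2 * K) / 12 + 1 := by
    exact_mod_cast h1
  have h2' : 1 + Module.finrank ℂ (CuspForm 𝒮ℒ ((2 * K : ℕ) : ℤ)) =
      if 2 * K ≡ 2 [MOD 12] then 2 * K / 12 else 2 * K / 12 + 1 := by
    exact_mod_cast h2
  unfold Nat.ModEq at h1' h2'
  generalize Module.finrank ℂ (ModularForm 𝒮ℒ ((12 * N + 2 - 2 * K : ℕ) : ℤ)) = x at *
  generalize Module.finrank ℂ (CuspForm 𝒮ℒ ((2 * K : ℕ) : ℤ)) = y at *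
  clear h1 h2
  by_cases c1 : (12 * N + 2 - 2 * K) % 12 = 2 % 12 <;> by_cases c2 : 2 * K % 12 = 2 % 12 <;>
    simp only [c1, c2, if_true, if_false] at h1' h2' <;> omega

def Amap (K N : ℕ) : CuspForm 𝒮ℒ ((2 * K : ℕ) : ℤ) →ₗ[ℂ] (Fin N → ℂ) where
  toFun f := fun i => (qExpansion 1 f).coeff (i + 1)
  map_add' f g := by
    ext i
    rw [FunLike.coe_add, ModularForm.qExpansion_add one_pos one_mem_strictPeriods_SL]
    simp
  map_smul' c f := by
    ext i
    rw [FunLike.coe_smul, ModularForm.qExpansion_smul one_pos one_mem_strictPeriods_SL]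
    simp

def Pmap (w N : ℕ) : ModularForm 𝒮ℒ (w : ℤ) →ₗ[ℂ] (Fin N → ℂ) where
  toFun h := fun i => (qExpansion 1 (h * uq ^ N)).coeff (N - 1 - i)
  map_add' f g := by
    ext i
    rw [FunLike.coe_add, add_mul, qExpansion_add ((nice_form f).mul (nice_uq.pow N)).an
      ((nice_form g).mul (nice_uq.pow N)).an]
    simp
  map_smul' c f := by
    ext i
    rw [FunLike.coe_smul, smul_mul_assoc, qExpansion_smul ((nice_form f).mul (nice_uq.pow N)).an]
    simp

lemma Amap_inj (K N : ℕ) (hK : 2 ≤ K) (hN : K ≤ N) : Function.Injective (Amap K N) := by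
  rw [injective_iff_map_eq_zero]
  intro f hf
  let f' : ModularForm 𝒮ℒ ((2 * K : ℕ) : ℤ) := (CuspForm.equivCuspFormSubmodule 𝒮ℒ _ f).1
  have hf' : (f' : ℍ → ℂ) = f := rfl
  have : f' = 0 := by
    apply sturm_bound_levelOne_nat
    rw [hf']
    refine lt_of_lt_of_le (b := ((N + 1 : ℕ) : ℕ∞)) ?_ ?_
    · exact_mod_cast (by omega : 2 * K / 12 < N + 1)
    · apply PowerSeries.nat_le_order
      intro i hi
      rcases i with _ | i
      · exact CuspFormClass.qExpansion_coeff_zero f one_pos one_mem_strictPeriods_SL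
      · exact congrFun hf ⟨i, by omega⟩
  ext τ
  have := congrArg (fun g : ModularForm 𝒮ℒ ((2 * K : ℕ) : ℤ) => g τ) this
  exact this

lemma Pmap_inj (K N : ℕ) (hK : 2 ≤ K) (hN : K ≤ N) :
    Function.Injective (Pmap (12 * N + 2 - 2 * K) N) := by
  rw [injective_iff_map_eq_zero]
  intro h hh
  apply sturm_bound_levelOne_nat
  have h0 : (N : ℕ∞) ≤ (qExpansion 1 (h * uq ^ N)).order := by
    apply PowerSeries.nat_le_order
    intro i hi
    have := congrFun hh ⟨N - 1 - i, by omega⟩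
    simp only [Pmap, LinearMap.coe_mk, AddHom.coe_mk, Pi.zero_apply] at this
    rwa [show N - 1 - (N - 1 - i) = i by omega] at this
  have h1 : qExpansion 1 (h * uq ^ N) * qExpansion 1 discriminant ^ N =
      qExpansion 1 h * PowerSeries.X ^ N := by
    rw [qExpansion_mul (nice_form h).an (nice_uq.pow N).an, nice_uq.qpow, mul_assoc, ← mul_pow,
      uq_mul]
  have h2 := congrArg PowerSeries.order h1
  rw [PowerSeries.order_mul, PowerSeries.order_mul, PowerSeries.order_pow, PowerSeries.order_pow,
    discriminant_qExpansion_order, PowerSeries.order_X] at h2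
  have h3 : (qExpansion 1 (h * uq ^ N)).order = (qExpansion 1 h).order := by
    simp only [nsmul_eq_mul, mul_one] at h2
    exact WithTop.add_right_cancel (ENat.natCast_ne_top N) h2
  rw [← h3]
  refine lt_of_lt_of_le ?_ h0
  exact_mod_cast (by omega : (12 * N + 2 - 2 * K) / 12 < N)

lemma exists_form (K N : ℕ) (hK : 2 ≤ K) (hN : K ≤ N) (l : Fin N → ℂ)
    (hl : ∀ f : CuspForm 𝒮ℒ ((2 * K : ℕ) : ℤ),
      ∑ i : Fin N, l i * (qExpansion 1 f).coeff (i + 1) = 0) :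
    ∃ h : ModularForm 𝒮ℒ ((12 * N + 2 - 2 * K : ℕ) : ℤ),
      ∀ i : Fin N, (qExpansion 1 (h * uq ^ N)).coeff (N - 1 - i) = l i := by
  have fdC : FiniteDimensional ℂ (CuspForm 𝒮ℒ ((2 * K : ℕ) : ℤ)) :=
    CuspForm.discriminantEquiv.symm.finiteDimensional
  let D := dotProductEquiv ℂ (Fin N)
  let P := D.toLinearMap ∘ₗ Pmap (12 * N + 2 - 2 * K) N
  have hPi : Function.Injective P := D.injective.comp (Pmap_inj K N hK hN)
  have hle : LinearMap.range P ≤ LinearMap.ker (Amap K N).dualMap := by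
    rintro _ ⟨h, rfl⟩
    rw [LinearMap.mem_ker]
    ext f
    exact orth K N hN f h
  have hsurj := LinearMap.dualMap_surjective_of_injective (Amap_inj K N hK hN)
  have hrn := LinearMap.finrank_range_add_finrank_ker (Amap K N).dualMap
  rw [LinearMap.range_eq_top.2 hsurj, finrank_top, Subspace.dual_finrank_eq,
    Subspace.dual_finrank_eq, Module.finrank_fin_fun] at hrn
  have hd := dims K N hK hN
  have heq := Submodule.eq_of_le_of_finrank_eq hle (by
    rw [LinearMap.finrank_range_of_inj hPi]; omega)
  have hmem : D l ∈ LinearMap.ker (Amap K N).dualMap := by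
    rw [LinearMap.mem_ker]
    ext f
    exact hl f
  rw [← heq] at hmem
  obtain ⟨h, hh⟩ := hmem
  exact ⟨h, fun i => congrFun (D.injective hh) i⟩

lemma e_q (n : ℤ) (τ : ℂ) : e ((n : ℂ) * τ) = 𝕢 1 τ ^ n := by
  rw [e, Function.Periodic.qParam, ← Complex.exp_int_mul]
  congr 1
  simp
  ring

lemma mob (γ : SL(2, ℤ)) (τ : ℍ) : ((γ • τ : ℍ) : ℂ) =
    ((γ.1 0 0 : ℂ) * τ + (γ.1 0 1 : ℂ)) / ((γ.1 1 0 : ℂ) * τ + (γ.1 1 1 : ℂ)) := by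
  rw [UpperHalfPlane.coe_specialLinearGroup_apply]
  simp

lemma den (γ : SL(2, ℤ)) (τ : ℍ) : denom γ τ = (γ.1 1 0 : ℂ) * τ + (γ.1 1 1 : ℂ) := by
  rw [ModularGroup.denom_apply]

/-- Functional equation restated on the upper half plane. -/
lemma fe_of {g : ℂ → ℂ} {w : ℤ} (hg : ∀ γ : Matrix.SpecialLinearGroup (Fin 2) ℤ, ∀ τ ∈ UHP,
          g (((γ.1 0 0 : ℂ) * τ + (γ.1 0 1 : ℂ)) / ((γ.1 1 0 : ℂ) * τ + (γ.1 1 1 : ℂ)))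
            = ((γ.1 1 0 : ℂ) * τ + (γ.1 1 1 : ℂ)) ^ w * g τ) (γ : SL(2, ℤ)) (τ : ℍ) :
    g ((γ • τ : ℍ) : ℂ) = denom γ τ ^ w * g τ := by
  rw [mob, den]
  exact hg γ τ τ.im_pos

lemma fe_to {F : ℍ → ℂ} {w : ℤ} (hF : ∀ (γ : SL(2, ℤ)) (τ : ℍ), F (γ • τ) = denom γ τ ^ w * F τ) :
    ∀ γ : Matrix.SpecialLinearGroup (Fin 2) ℤ, ∀ τ ∈ UHP,
      (F ∘ ofComplex) (((γ.1 0 0 : ℂ) * τ + (γ.1 0 1 : ℂ)) / ((γ.1 1 0 : ℂ) * τ + (γ.1 1 1 : ℂ)))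
        = ((γ.1 1 0 : ℂ) * τ + (γ.1 1 1 : ℂ)) ^ w * (F ∘ ofComplex) τ := by
  intro γ τ hτ
  have h := hF γ ⟨τ, hτ⟩
  rw [den] at h
  have hm := mob γ ⟨τ, hτ⟩
  simp only at hm h
  rw [← hm, Function.comp_apply, ofComplex_apply, Function.comp_apply,
    ofComplex_apply_of_im_pos hτ, h]

lemma mdiff_of {g : ℂ → ℂ} (hg : DifferentiableOn ℂ g UHP) : MDiff (fun τ : ℍ => g τ) := by
  rw [UpperHalfPlane.mdifferentiable_iff]
  refine DifferentiableOn.congr hg ?_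
  intro z hz
  simp [ofComplex_apply_of_im_pos hz]

lemma T_of {g : ℂ → ℂ} {w : ℤ} (hg : ∀ (γ : SL(2, ℤ)) (τ : ℍ),
    g ((γ • τ : ℍ) : ℂ) = denom γ τ ^ w * g τ) (τ : ℍ) :
    g (((1 : ℝ) +ᵥ τ : ℍ) : ℂ) = g τ := by
  have h := hg ModularGroup.T τ
  rw [UpperHalfPlane.modular_T_smul, den] at h
  simpa [ModularGroup.T] using h

lemma dir2 (k : ℤ) (lam : ℕ → ℤ) (f : ℂ → ℂ) (a : ℕ → ℂ) (hf : DifferentiableOn ℂ f UHP)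
    (hf2 : ∀ (γ : SL(2, ℤ)) (τ : ℍ), f ((γ • τ : ℍ) : ℂ) = denom γ τ ^ (2 * k) * f τ)
    (hf3 : ∀ τ ∈ UHP, HasSum (fun m : ℕ => a (m + 1) * e (((m + 1 : ℕ) : ℂ) * τ)) (f τ))
    (g : ℂ → ℂ) (N : ℕ) (c : ℤ → ℂ) (hg : DifferentiableOn ℂ g UHP)
    (hg2 : ∀ (γ : SL(2, ℤ)) (τ : ℍ), g ((γ • τ : ℍ) : ℂ) = denom γ τ ^ (2 - 2 * k) * g τ)
    (hc : ∀ n : ℤ, n < -(N : ℤ) → c n = 0)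
    (hg3 : ∀ τ ∈ UHP, HasSum (fun n : ℤ => c n * e ((n : ℂ) * τ)) (g τ))
    (hl : ∀ m : ℕ, 1 ≤ m → c (-(m : ℤ)) = (lam m : ℂ)) :
    (∑' m : ℕ, (lam (m + 1) : ℂ) * a (m + 1)) = 0 := by
  obtain ⟨nF, cF⟩ := nice_of_hasSum (fun τ : ℍ => f τ) (fun m => if m = 0 then 0 else a m)
    (mdiff_of hf) (T_of hf2) (by
      intro τ
      rw [← hasSum_nat_add_iff' 1]
      simp only [Finset.sum_range_one, if_true, zero_smul, sub_zero]
      convert! hf3 τ τ.im_pos using 2 with m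
      have := e_q ((m + 1 : ℕ) : ℤ) τ
      rw [zpow_natCast] at this
      simp only [Int.cast_natCast] at this
      rw [this]
      simp)
  obtain ⟨nG, cG⟩ := nice_of_hasSum (fun τ : ℍ => 𝕢 1 τ ^ N * g τ) (fun m => c ((m : ℤ) - N))
    ((nice_q.1.pow N).hol.mul (mdiff_of hg)) (fun τ => by rw [q_shift, T_of hg2]) (by
      intro τ
      have h1 := (hg3 τ τ.im_pos).mul_left (𝕢 1 (τ : ℂ) ^ N)
      have hinj : Function.Injective (fun m : ℕ => (m : ℤ) - N) := by
        intro x y hxy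
        simpa using hxy
      rw [← hinj.hasSum_iff] at h1
      · refine h1.congr_fun ?_
        intro m
        have hq := Function.Periodic.qParam_ne_zero (h := 1) (τ : ℂ)
        simp only [Function.comp_apply, e_q, smul_eq_mul]
        rw [zpow_sub₀ hq, zpow_natCast, zpow_natCast]
        field_simp
      · intro n hn
        rw [hc n, zero_mul, mul_zero]
        by_contra hlt
        exact hn ⟨(n + N).toNat, by simp only; omega⟩)
  have hp := pairing _ _ nF nG N ?_
  · simp only [cF, cG] at hp
    rw [Finset.Nat.sum_antidiagonal_eq_sum_range_succ
      (fun i j => (if i = 0 then 0 else a i) * c ((j : ℤ) - N)), Finset.sum_range_succ'] at hp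
    rw [tsum_eq_sum (s := Finset.range N)]
    · rw [← hp]
      simp only [if_true, zero_mul, add_zero]
      refine Finset.sum_congr rfl fun i hi => ?_
      rw [Finset.mem_range] at hi
      rw [← hl _ (by omega), if_neg (by omega), mul_comm]
      congr 2
      omega
    · intro m hm
      rw [Finset.mem_range] at hm
      rw [← hl _ (by omega), hc _ (by omega), zero_mul]
  · intro τ
    have hτ := τ.ne_zero
    have hq := Function.Periodic.qParam_ne_zero (h := 1) (τ : ℂ)
    have hq' := Function.Periodic.qParam_ne_zero (h := 1) ((ModularGroup.S • τ : ℍ) : ℂ)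
    rw [hf2, hg2, ModularGroup.denom_S]
    have hw : (τ : ℂ) ^ (2 * k) * (τ : ℂ) ^ (2 - 2 * k) = (τ : ℂ) ^ 2 := by
      rw [← zpow_add₀ hτ, ← zpow_natCast]; congr 1; push_cast; ring
    generalize (τ : ℂ) ^ (2 * k) = A at *
    generalize (τ : ℂ) ^ (2 - 2 * k) = B at *
    field_simp
    linear_combination (f τ * g τ) * hw

lemma dir1 (K : ℕ) (hK : 2 ≤ K) (lam : ℕ → ℤ) (hfin : Set.Finite {m : ℕ | lam m ≠ 0})
    (H : ∀ (f : ℂ → ℂ) (a : ℕ → ℂ),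
        DifferentiableOn ℂ f UHP →
        (∀ γ : Matrix.SpecialLinearGroup (Fin 2) ℤ, ∀ τ ∈ UHP,
          f (((γ.1 0 0 : ℂ) * τ + (γ.1 0 1 : ℂ)) / ((γ.1 1 0 : ℂ) * τ + (γ.1 1 1 : ℂ)))
            = ((γ.1 1 0 : ℂ) * τ + (γ.1 1 1 : ℂ)) ^ (2 * (K : ℤ)) * f τ) →
        (∀ τ ∈ UHP,
          HasSum (fun m : ℕ => a (m + 1) * e (((m + 1 : ℕ) : ℂ) * τ)) (f τ)) →
        (∑' m : ℕ, (lam (m + 1) : ℂ) * a (m + 1)) = 0) :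
    (∃ (g : ℂ → ℂ) (N : ℕ) (c : ℤ → ℂ),
        DifferentiableOn ℂ g UHP ∧
        (∀ γ : Matrix.SpecialLinearGroup (Fin 2) ℤ, ∀ τ ∈ UHP,
          g (((γ.1 0 0 : ℂ) * τ + (γ.1 0 1 : ℂ)) / ((γ.1 1 0 : ℂ) * τ + (γ.1 1 1 : ℂ)))
            = ((γ.1 1 0 : ℂ) * τ + (γ.1 1 1 : ℂ)) ^ (2 - 2 * (K : ℤ)) * g τ) ∧
        (∀ n : ℤ, n < -(N : ℤ) → c n = 0) ∧
        (∀ τ ∈ UHP, HasSum (fun n : ℤ => c n * e ((n : ℂ) * τ)) (g τ)) ∧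
        (∀ m : ℕ, 1 ≤ m → c (-(m : ℤ)) = (lam m : ℂ))) := by
  obtain ⟨N0, hN0⟩ := hfin.bddAbove
  obtain ⟨N, hKN, hN⟩ : ∃ N, K ≤ N ∧ ∀ m, N < m → lam m = 0 := by
    refine ⟨max K N0, le_max_left _ _, fun m hm => ?_⟩
    by_contra h
    have := hN0 h
    omega
  obtain ⟨h, hh⟩ := exists_form K N hK hKN (fun i => (lam (i + 1) : ℂ)) (by
    intro φ
    have nφ := nice_form φ
    have := H (φ ∘ ofComplex) (fun m => (qExpansion 1 φ).coeff m)
      (UpperHalfPlane.mdifferentiable_iff.1 nφ.hol)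
      (by
        have := fe_to (form_eqn φ)
        push_cast at this
        exact this)
      (by
        intro τ hτ
        have h1 := UpperHalfPlane.hasSum_qExpansion one_pos nφ.per nφ.hol nφ.bdd ⟨τ, hτ⟩
        rw [← hasSum_nat_add_iff' 1] at h1
        simp only [Finset.sum_range_one, CuspFormClass.qExpansion_coeff_zero φ one_pos
          one_mem_strictPeriods_SL, zero_smul, sub_zero] at h1
        rw [Function.comp_apply, ofComplex_apply_of_im_pos hτ]
        refine h1.congr_fun ?_
        intro m
        have := e_q ((m + 1 : ℕ) : ℤ) τ
        rw [zpow_natCast] at this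
        simp only [Int.cast_natCast] at this
        rw [this]
        simp)
    rw [tsum_eq_sum (s := Finset.range N), Finset.sum_range] at this
    · exact this
    · intro m hm
      rw [Finset.mem_range] at hm
      rw [hN _ (by omega)]
      simp)
  set G : ℍ → ℂ := h * uq ^ N with hG
  have nG : Nice G := (nice_form h).mul (nice_uq.pow N)
  set F : ℍ → ℂ := fun τ => h τ / discriminant τ ^ N with hF
  have hGF : ∀ τ, G τ = F τ * 𝕢 1 τ ^ N := by
    intro τ
    simp only [hG, hF, Pi.mul_apply, Pi.pow_apply, uq, div_pow]
    ring
  refine ⟨F ∘ ofComplex, N, fun n => if n < -(N : ℤ) then 0 else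
    (qExpansion 1 G).coeff (n + N).toNat, ?_, ?_, ?_, ?_, ?_⟩
  · have h1 : MDiff (discriminant ^ N) := by
      have := ((nice_form CuspForm.discriminant).pow N).hol
      rwa [CuspForm.coe_discriminant] at this
    exact UpperHalfPlane.mdifferentiable_iff.1 ((nice_form h).hol.div h1
      (fun τ => pow_ne_zero _ (discriminant_ne_zero τ)))
  · apply fe_to
    intro γ τ
    have h2 := form_eqn h γ τ
    have h3 := form_eqn CuspForm.discriminant γ τ
    rw [CuspForm.coe_discriminant] at h3
    have hd := discriminant_ne_zero τ
    have hτ := denom_ne_zero γ τ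
    simp only [hF]
    rw [h2, h3, mul_pow]
    have hw : (denom γ τ) ^ ((12 * N + 2 - 2 * K : ℕ) : ℤ) =
        (denom γ τ) ^ (2 - 2 * (K : ℤ)) * ((denom γ τ) ^ (12 : ℤ)) ^ N := by
      rw [← zpow_natCast (_ ^ (12 : ℤ)), ← zpow_mul, ← zpow_add₀ hτ]
      congr 1; omega
    rw [hw]
    have : ((denom γ τ) ^ (12 : ℤ)) ^ N ≠ 0 := pow_ne_zero _ (zpow_ne_zero _ hτ)
    field_simp
  · intro n hn
    simp [hn]
  · intro τ hτ
    rw [Function.comp_apply, ofComplex_apply_of_im_pos hτ]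
    have h1 := UpperHalfPlane.hasSum_qExpansion one_pos nG.per nG.hol nG.bdd ⟨τ, hτ⟩
    have hq := Function.Periodic.qParam_ne_zero (h := 1) τ
    have hinj : Function.Injective (fun m : ℕ => (m : ℤ) - N) := by
      intro x y hxy
      simpa using hxy
    rw [← hinj.hasSum_iff]
    · have h2 := h1.div_const (𝕢 1 τ ^ N)
      rw [hGF] at h2
      simp only at h2
      rw [mul_div_assoc, div_self (pow_ne_zero _ hq), mul_one] at h2
      refine h2.congr_fun ?_
      intro m
      simp only [Function.comp_apply, e_q, smul_eq_mul]
      rw [zpow_sub₀ hq, zpow_natCast, zpow_natCast, if_neg (by omega)]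
      simp [mul_div_assoc]
    · intro n hn
      have : n < -(N : ℤ) := by
        by_contra hlt
        exact hn ⟨(n + N).toNat, by simp only; omega⟩
      simp [this]
  · intro m hm
    by_cases hmN : N < m
    · simp only
      rw [if_pos (by omega), hN m hmN]
      simp
    · simp only
      rw [if_neg (by omega)]
      have := hh ⟨m - 1, by omega⟩
      simp only at this
      rw [show m - 1 + 1 = m by omega] at this
      rw [← this]
      rw [show (-(m : ℤ) + N).toNat = N - 1 - (m - 1) by omega]

end

/-- For an integer `k > 1` and a finitely supported sequence
`λ : ℕ≥1 → ℤ` (modelled as `lam : ℕ → ℤ`, only values at `m ≥ 1` being used),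
the following are equivalent:
(i) for every cusp form `f` of weight `2k` for `SL₂(ℤ)` with Fourier coefficients
`a : ℕ≥1 → ℂ`, one has `Σ_{m≥1} λ_m a_m = 0`;
(ii) there is a weakly holomorphic modular form `g` of weight `2 − 2k` for `SL₂(ℤ)`
with Fourier expansion `g(τ) = Σ_{n ≥ −N} c(n) e(nτ)` and `c(−m) = λ_m` for all `m ≥ 1`. -/
theorem stmt0 (k : ℤ) (hk : 1 < k) (lam : ℕ → ℤ)
    (hfin : Set.Finite {m : ℕ | lam m ≠ 0}) :
    (∀ (f : ℂ → ℂ) (a : ℕ → ℂ),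
        DifferentiableOn ℂ f UHP →
        (∀ γ : Matrix.SpecialLinearGroup (Fin 2) ℤ, ∀ τ ∈ UHP,
          f (((γ.1 0 0 : ℂ) * τ + (γ.1 0 1 : ℂ)) / ((γ.1 1 0 : ℂ) * τ + (γ.1 1 1 : ℂ)))
            = ((γ.1 1 0 : ℂ) * τ + (γ.1 1 1 : ℂ)) ^ (2 * k) * f τ) →
        (∀ τ ∈ UHP,
          HasSum (fun m : ℕ => a (m + 1) * e (((m + 1 : ℕ) : ℂ) * τ)) (f τ)) →
        (∑' m : ℕ, (lam (m + 1) : ℂ) * a (m + 1)) = 0)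
    ↔
    (∃ (g : ℂ → ℂ) (N : ℕ) (c : ℤ → ℂ),
        DifferentiableOn ℂ g UHP ∧
        (∀ γ : Matrix.SpecialLinearGroup (Fin 2) ℤ, ∀ τ ∈ UHP,
          g (((γ.1 0 0 : ℂ) * τ + (γ.1 0 1 : ℂ)) / ((γ.1 1 0 : ℂ) * τ + (γ.1 1 1 : ℂ)))
            = ((γ.1 1 0 : ℂ) * τ + (γ.1 1 1 : ℂ)) ^ (2 - 2 * k) * g τ) ∧
        (∀ n : ℤ, n < -(N : ℤ) → c n = 0) ∧
        (∀ τ ∈ UHP, HasSum (fun n : ℤ => c n * e ((n : ℂ) * τ)) (g τ)) ∧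
        (∀ m : ℕ, 1 ≤ m → c (-(m : ℤ)) = (lam m : ℂ))) := by
  constructor
  · intro H
    obtain ⟨K, rfl⟩ := Int.eq_ofNat_of_zero_le (by omega : 0 ≤ k)
    exact dir1 K (by omega) lam hfin H
  · rintro ⟨g, N, c, hg, hg2, hc, hg3, hl⟩ f a hf hf2 hf3
    exact dir2 k lam f a hf (fe_of hf2) hf3 g N c hg (fe_of hg2) hc hg3 hl
end
end

section
/- Let k > 1 be an integer. Suppose g : ℍ → ℂ is holomorphic, satisfies g((aτ+b)/(cτ+d)) = (cτ+d)^{2−2k} g(τ) for all [[a,b],[c,d]] ∈ SL₂(ℤ), and admits a Fourier expansion g(τ) = Σ_{n≥−N} c(n) e(nτ) (absolutely convergent on ℍ) for some N ∈ ℕ. If c(−m) ∈ ℤ for every integer m ≥ 1, then c(n) ∈ ℤ for every integer n. -/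
noncomputable section

open Complex Real
section Helpers

open scoped MatrixGroups Manifold
open ModularForm UpperHalfPlane EisensteinSeries

/-- Coefficients of index `< N` are integers. -/
def IntTo (N : ℕ) (p : PowerSeries ℂ) : Prop := ∀ m < N, ∃ z : ℤ, p.coeff m = (z : ℂ)

/-- All coefficients are integers. -/
def IntPS : Subring (PowerSeries ℂ) := (PowerSeries.map (Int.castRingHom ℂ)).range

lemma mem_IntPS {p : PowerSeries ℂ} : p ∈ IntPS ↔ ∀ m, ∃ z : ℤ, p.coeff m = (z : ℂ) := by
  constructor
  · rintro ⟨u, rfl⟩ m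
    exact ⟨u.coeff m, by simp⟩
  · intro h
    choose z hz using h
    exact ⟨PowerSeries.mk z, by ext m; simp [hz]⟩

lemma IntPS.intTo {p : PowerSeries ℂ} (h : p ∈ IntPS) (N : ℕ) : IntTo N p :=
  fun m _ => mem_IntPS.1 h m

lemma IntTo.mul {N : ℕ} {p q : PowerSeries ℂ} (hp : IntTo N p) (hq : IntTo N q) :
    IntTo N (p * q) := by
  intro m hm
  rw [PowerSeries.coeff_mul]
  have : ∀ x ∈ Finset.HasAntidiagonal.antidiagonal m, p.coeff x.1 * q.coeff x.2 ∈ (Int.castRingHom ℂ).range := by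
    intro x hx
    rw [Finset.HasAntidiagonal.mem_antidiagonal] at hx
    obtain ⟨a, ha⟩ := hp x.1 (by omega)
    obtain ⟨b, hb⟩ := hq x.2 (by omega)
    exact ⟨a * b, by simp [ha, hb]⟩
  obtain ⟨z, hz⟩ := sum_mem this
  exact ⟨z, by rw [← hz]; simp⟩

lemma E4_int : ∃ A : ℕ → ℤ, (∀ m, A m = if m = 0 then 0 else (ArithmeticFunction.sigma 3 m : ℤ)) ∧
    qExpansion 1 E₄ = 1 + 240 * PowerSeries.map (Int.castRingHom ℂ) (PowerSeries.mk A) := by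
  refine ⟨_, fun _ => rfl, ?_⟩
  ext m
  rw [show (240 : PowerSeries ℂ) = PowerSeries.C 240 from (map_ofNat PowerSeries.C 240).symm]
  rw [E_qExpansion_coeff _ ⟨2, rfl⟩, show bernoulli 4 = -1 / 30 by decide +kernel]
  rcases eq_or_ne m 0 with rfl | hm
  · simp only [map_add, map_sub, PowerSeries.coeff_C_mul, PowerSeries.coeff_map,
      PowerSeries.coeff_one, PowerSeries.coeff_mk]
    simp
  · simp only [map_add, map_sub, PowerSeries.coeff_C_mul, PowerSeries.coeff_map,
      PowerSeries.coeff_one, PowerSeries.coeff_mk]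
    simp [hm]
    norm_num

lemma E6_int : ∃ A : ℕ → ℤ, (∀ m, A m = if m = 0 then 0 else (ArithmeticFunction.sigma 5 m : ℤ)) ∧
    qExpansion 1 E₆ = 1 - 504 * PowerSeries.map (Int.castRingHom ℂ) (PowerSeries.mk A) := by
  refine ⟨_, fun _ => rfl, ?_⟩
  ext m
  rw [show (504 : PowerSeries ℂ) = PowerSeries.C 504 from (map_ofNat PowerSeries.C 504).symm]
  rw [E_qExpansion_coeff _ ⟨3, rfl⟩, show bernoulli 6 = 1 / 42 by decide +kernel]
  rcases eq_or_ne m 0 with rfl | hm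
  · simp only [map_add, map_sub, PowerSeries.coeff_C_mul, PowerSeries.coeff_map,
      PowerSeries.coeff_one, PowerSeries.coeff_mk]
    simp
  · simp only [map_add, map_sub, PowerSeries.coeff_C_mul, PowerSeries.coeff_map,
      PowerSeries.coeff_one, PowerSeries.coeff_mk]
    simp [hm]
    norm_num

lemma sigma_dvd (m : ℕ) : (12 : ℤ) ∣ 5 * (ArithmeticFunction.sigma 3 m : ℤ)
    + 7 * (ArithmeticFunction.sigma 5 m : ℤ) := by
  simp only [ArithmeticFunction.sigma_apply]
  push_cast
  rw [Finset.mul_sum, Finset.mul_sum, ← Finset.sum_add_distrib]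
  refine Finset.dvd_sum fun d _ => ?_
  have : ∀ x : ZMod 12, 5 * x ^ 3 + 7 * x ^ 5 = 0 := by decide
  have h := this (d : ZMod 12)
  rw [show (12 : ℤ) = ((12 : ℕ) : ℤ) from rfl, ← ZMod.intCast_zmod_eq_zero_iff_dvd]
  push_cast
  exact h

lemma delta_q : 1728 * qExpansion 1 ModularForm.discriminant =
    qExpansion 1 E₄ ^ 3 - qExpansion 1 E₆ ^ 2 := by
  have h : ((E₄.pow 3 : ModularForm 𝒮ℒ _) : ℍ → ℂ) =
      ((1728 : ℂ) • CuspForm.discriminant : CuspForm 𝒮ℒ 12) + ((E₆.pow 2 : ModularForm 𝒮ℒ _) : ℍ → ℂ) := by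
    ext z
    have := discriminant_eq_E₄_cube_sub_E₆_sq z
    simp only [ModularForm.coe_pow, Pi.add_apply, Pi.pow_apply, FunLike.coe_smul, Pi.smul_apply, CuspForm.coe_discriminant, this, smul_eq_mul]
    ring
  have h2 := congrArg (qExpansion 1) h
  rw [ModularForm.qExpansion_add one_pos one_mem_strictPeriods_SL, 
    ModularForm.qExpansion_pow one_pos one_mem_strictPeriods_SL,
    ModularForm.qExpansion_pow one_pos one_mem_strictPeriods_SL, FunLike.coe_smul,
    ModularForm.qExpansion_smul one_pos one_mem_strictPeriods_SL] at h2
  rw [h2]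
  rw [PowerSeries.smul_eq_C_mul, map_ofNat, CuspForm.coe_discriminant]
  ring

lemma delta_int : qExpansion 1 ModularForm.discriminant ∈ IntPS := by
  obtain ⟨A, hA, h4⟩ := E4_int
  obtain ⟨B, hB, h6⟩ := E6_int
  have hd : ∀ m, ∃ c, 5 * A m + 7 * B m = 12 * c := by
    intro m
    rw [hA, hB]
    split_ifs
    · exact ⟨0, by simp⟩
    · exact sigma_dvd m
  choose c hc using hd
  set a : PowerSeries ℤ := PowerSeries.mk A
  set b : PowerSeries ℤ := PowerSeries.mk B
  set u : PowerSeries ℤ := PowerSeries.mk c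
  have hu : 5 * a + 7 * b = 12 * u := by
    ext m
    rw [show (5 : PowerSeries ℤ) = PowerSeries.C 5 from (map_ofNat PowerSeries.C 5).symm,
      show (7 : PowerSeries ℤ) = PowerSeries.C 7 from (map_ofNat PowerSeries.C 7).symm,
      show (12 : PowerSeries ℤ) = PowerSeries.C 12 from (map_ofNat PowerSeries.C 12).symm]
    simp only [a, b, u, map_add, PowerSeries.coeff_C_mul, PowerSeries.coeff_mk, hc]
  have hu' := congrArg (PowerSeries.map (Int.castRingHom ℂ)) hu
  simp only [map_add, map_mul, map_ofNat] at hu'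
  have key := delta_q
  rw [h4, h6] at key
  refine ⟨100 * a ^ 2 + 8000 * a ^ 3 - 147 * b ^ 2 + u, ?_⟩
  have h0 : (1728 : PowerSeries ℂ) ≠ 0 := by
    rw [show (1728 : PowerSeries ℂ) = PowerSeries.C 1728 from (map_ofNat PowerSeries.C 1728).symm]
    intro h
    have := congrArg (PowerSeries.coeff 0) h
    rw [PowerSeries.coeff_C] at this
    norm_num at this
  apply mul_left_cancel₀ h0
  rw [key]
  simp only [map_add, map_sub, map_mul, map_ofNat, map_pow]
  linear_combination (-144) * hu'

lemma delta_unit : ∃ U V : PowerSeries ℂ, U ∈ IntPS ∧ V ∈ IntPS ∧ U * V = 1 ∧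
    qExpansion 1 ModularForm.discriminant = PowerSeries.X * U := by
  obtain ⟨d, hd⟩ := delta_int
  have h1 := discriminant_qExpansion_coeff_one
  have h0 : (qExpansion 1 ModularForm.discriminant).coeff 0 = 0 := 
    CuspFormClass.qExpansion_coeff_zero CuspForm.discriminant one_pos
    one_mem_strictPeriods_SL
  rw [← hd] at h0 h1
  have h0' : d.constantCoeff = 0 := by simpa using h0
  have h1' : d.coeff 1 = 1 := by
    rw [PowerSeries.coeff_map, eq_intCast] at h1
    exact_mod_cast h1
  obtain ⟨u, rfl⟩ := PowerSeries.X_dvd_iff.2 h0'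
  have hu : IsUnit u := by
    rw [PowerSeries.isUnit_iff_constantCoeff]
    have : u.constantCoeff = 1 := by
      rw [← h1', mul_comm, ← zero_add 1, PowerSeries.coeff_succ_mul_X]; simp
    simp [this]
  obtain ⟨v, hv⟩ := hu.exists_right_inv
  refine ⟨_, _, ⟨u, rfl⟩, ⟨v, rfl⟩, ?_, ?_⟩
  · rw [← map_mul, hv, map_one]
  · rw [← hd]; simp

lemma eis_exists (W : ℤ) (hW : Even W) (h4 : 4 ≤ W) : ∃ F : ModularForm 𝒮ℒ W,
    qExpansion 1 F ∈ IntPS ∧ (qExpansion 1 F).coeff 0 = 1 := by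
  obtain ⟨a, b, hab⟩ : ∃ a b : ℕ, (a : ℤ) * 4 + (b : ℤ) * 6 = W := by
    obtain ⟨r, rfl⟩ := hW
    rcases Int.even_or_odd' r with ⟨s, rfl | rfl⟩
    · exact ⟨s.toNat, 0, by omega⟩
    · exact ⟨(s - 1).toNat, 1, by omega⟩
  obtain ⟨A, hA, h4⟩ := E4_int
  obtain ⟨B, hB, h6⟩ := E6_int
  have i4 : qExpansion 1 E₄ ∈ IntPS := ⟨1 + 240 * PowerSeries.mk A, by
    rw [h4]; simp only [map_add, map_mul, map_one, map_ofNat]⟩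
  have i6 : qExpansion 1 E₆ ∈ IntPS := ⟨1 - 504 * PowerSeries.mk B, by
    rw [h6]; simp only [map_sub, map_mul, map_one, map_ofNat]⟩
  have c4 : (qExpansion 1 E₄).constantCoeff = 1 := by
    simpa using E_qExpansion_coeff_zero (k := 4) (by norm_num) ⟨2, rfl⟩
  have c6 : (qExpansion 1 E₆).constantCoeff = 1 := by
    simpa using E_qExpansion_coeff_zero (k := 6) (by norm_num) ⟨3, rfl⟩
  have key : qExpansion 1 (ModularForm.mcast hab ((E₄.pow a).mul (E₆.pow b)) : ModularForm 𝒮ℒ W)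
      = qExpansion 1 E₄ ^ a * qExpansion 1 E₆ ^ b := by
    rw [ModularForm.qExpansion_mcast, ModularForm.qExpansion_mul one_pos one_mem_strictPeriods_SL,
      ModularForm.qExpansion_pow one_pos one_mem_strictPeriods_SL,
      ModularForm.qExpansion_pow one_pos one_mem_strictPeriods_SL]
  refine ⟨ModularForm.mcast hab ((E₄.pow a).mul (E₆.pow b)), ?_, ?_⟩
  · rw [key]
    exact mul_mem (pow_mem i4 _) (pow_mem i6 _)
  · rw [key, PowerSeries.coeff_zero_eq_constantCoeff_apply, map_mul, map_pow, map_pow, c4, c6]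
    simp

lemma main_ind (N : ℕ) : ∀ W : ℤ, Even W → W < 12 * N → ∀ F : ModularForm 𝒮ℒ W,
    IntTo N (qExpansion 1 F) → qExpansion 1 F ∈ IntPS := by
  induction N with
  | zero =>
    intro W _ hW F _
    rw [ModularFormClass.levelOne_neg_weight_eq_zero (by simpa using hW) F, qExpansion_zero]
    exact zero_mem _
  | succ N ih =>
    intro W hE hW F hF
    rcases lt_or_ge W 4 with h4 | h4
    · have : W < 0 ∨ W = 0 ∨ W = 2 := by
        obtain ⟨r, rfl⟩ := hE
        omega
      rcases this with h | rfl | rfl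
      · rw [ModularFormClass.levelOne_neg_weight_eq_zero h F, qExpansion_zero]
        exact zero_mem _
      · obtain ⟨c, hc⟩ := ModularFormClass.levelOne_weight_zero_const F
        have : (F : ℍ → ℂ) = c • ((1 : ModularForm 𝒮ℒ 0) : ℍ → ℂ) := by
          rw [hc]; ext; simp
        have h2 : qExpansion 1 F = PowerSeries.C c := by
          rw [this, ModularForm.qExpansion_smul one_pos one_mem_strictPeriods_SL,
            ModularForm.qExpansion_one, PowerSeries.smul_eq_C_mul, mul_one]
        obtain ⟨z, hz⟩ := hF 0 (by omega)
        rw [h2, PowerSeries.coeff_zero_C] at hz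
        rw [h2, hz]
        exact ⟨PowerSeries.C z, by simp⟩
      · have := rank_zero_iff_forall_zero.1 ModularForm.levelOne_weight_two_rank_zero F
        rw [this, show ((0 : ModularForm 𝒮ℒ 2) : ℍ → ℂ) = 0 from rfl, qExpansion_zero]
        exact zero_mem _
    · obtain ⟨E, hEi, hE0⟩ := eis_exists W hE h4
      obtain ⟨U, V, hU, hV, hUV, hD⟩ := delta_unit
      obtain ⟨z, hz⟩ := hF 0 (by omega)
      set F1 : ModularForm 𝒮ℒ W := F - (z : ℂ) • E
      have hF1 : qExpansion 1 F1 = qExpansion 1 F - PowerSeries.C (z : ℂ) * qExpansion 1 E := by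
        rw [← PowerSeries.smul_eq_C_mul, 
          ← ModularForm.qExpansion_smul one_pos one_mem_strictPeriods_SL, ← FunLike.coe_smul,
          ← ModularForm.qExpansion_sub one_pos one_mem_strictPeriods_SL, ← FunLike.coe_sub]
      have hzi : PowerSeries.C (z : ℂ) ∈ IntPS := ⟨PowerSeries.C z, by simp⟩
      have h0 : (qExpansion 1 F1).coeff 0 = 0 := by
        rw [hF1, map_sub, PowerSeries.coeff_C_mul, hE0, hz]; simp
      have hfac := qExpansion_eq_qExpansion_discriminant_mul F1 h0
      set H := CuspForm.discriminantEquiv (toCuspForm F1 h0)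
      rw [hD] at hfac
      have hF1i : IntTo (N + 1) (qExpansion 1 F1) := by
        rw [hF1]
        intro m hm
        obtain ⟨a, ha⟩ := hF m hm
        obtain ⟨b, hb⟩ := mem_IntPS.1 (mul_mem hzi hEi) m
        exact ⟨a - b, by rw [map_sub, ha, hb]; push_cast; rfl⟩
      have hXH : PowerSeries.X * qExpansion 1 H = qExpansion 1 F1 * V := by
        rw [hfac]; linear_combination (- PowerSeries.X * qExpansion 1 H) * hUV
      have hH : qExpansion 1 H ∈ IntPS := by
        refine ih (W - 12) ?_ ?_ H ?_
        · exact hE.sub ⟨6, rfl⟩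
        · push_cast at hW; omega
        · intro m hm
          have := (hF1i.mul (IntPS.intTo hV _)) (m + 1) (by omega)
          rwa [← hXH, mul_comm, PowerSeries.coeff_succ_mul_X] at this
      have hX : (PowerSeries.X : PowerSeries ℂ) ∈ IntPS := ⟨PowerSeries.X, by simp⟩
      have hF1' : qExpansion 1 F1 ∈ IntPS := by
        rw [hfac]; exact mul_mem (mul_mem hX hU) hH
      have : qExpansion 1 F = qExpansion 1 F1 + PowerSeries.C (z : ℂ) * qExpansion 1 E := by
        rw [hF1]; ring
      rw [this]
      exact add_mem hF1' (mul_mem hzi hEi)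

lemma periodic_of_hasSum {f : ℍ → ℂ} {c : ℕ → ℂ}
    (hf : ∀ τ : ℍ, HasSum (fun m ↦ c m • Function.Periodic.qParam 1 τ ^ m) (f τ)) :
    Function.Periodic (f ∘ ofComplex) (1 : ℝ) := by
  intro w
  by_cases hw : 0 < w.im
  · have hw' : 0 < (w + (1 : ℝ)).im := by simpa using hw
    simp only [Function.comp_apply, ofComplex_apply_of_im_pos hw', ofComplex_apply_of_im_pos hw]
    have h1 := hf ⟨w, hw⟩
    have h2 := hf ⟨_, hw'⟩
    have : Function.Periodic.qParam 1 (w + (1 : ℝ)) = Function.Periodic.qParam 1 w := by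
      simp only [Function.Periodic.qParam, Complex.ofReal_one, div_one]
      rw [mul_add, mul_one, Complex.exp_add, Complex.exp_two_pi_mul_I, mul_one]
    simp only [this] at h2
    exact h2.unique h1
  · have hw' : (w + (1 : ℝ)).im ≤ 0 := by simpa using hw
    simp only [Function.comp_apply, ofComplex_apply_of_im_nonpos hw',
       ofComplex_apply_of_im_nonpos (not_lt.1 hw)]

lemma analytic_of_hasSum {f : ℍ → ℂ} {c : ℕ → ℂ}
    (hf : ∀ τ : ℍ, HasSum (fun m ↦ c m • Function.Periodic.qParam 1 τ ^ m) (f τ))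
    (hd : MDiff f) : AnalyticAt ℂ (cuspFunction 1 f) 0 :=
  analyticAt_cuspFunction_zero one_pos (periodic_of_hasSum hf) hd
    (isBoundedAtImInfty_of_hasSum_qExpansion one_pos hf)

lemma qExpansion_of_hasSum {f : ℍ → ℂ} {c : ℕ → ℂ}
    (hf : ∀ τ : ℍ, HasSum (fun m ↦ c m • Function.Periodic.qParam 1 τ ^ m) (f τ))
    (hd : MDiff f) : qExpansion 1 f = PowerSeries.mk c := by
  ext m
  rw [PowerSeries.coeff_mk]
  have h1 := (hasFPowerSeriesOnBall_cuspFunction one_pos (analytic_of_hasSum hf hd)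
    hf).hasFPowerSeriesAt
  have h2 := (hasSum_qExpansion one_pos (periodic_of_hasSum hf) hd
    (isBoundedAtImInfty_of_hasSum_qExpansion one_pos hf))
  have h3 := (hasFPowerSeriesOnBall_cuspFunction one_pos (analytic_of_hasSum hf hd)
    h2).hasFPowerSeriesAt
  simpa using congr_arg (FormalMultilinearSeries.coeff · m) (h3.eq_formalMultilinearSeries h1)

lemma stmt2_aux (k : ℤ) (hk : 1 < k) (g : ℂ → ℂ) (N : ℕ) (c : ℤ → ℂ)
    (hg : DifferentiableOn ℂ g UHP)
    (htrans : ∀ γ : Matrix.SpecialLinearGroup (Fin 2) ℤ, ∀ τ ∈ UHP,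
      g (((γ.1 0 0 : ℂ) * τ + (γ.1 0 1 : ℂ)) / ((γ.1 1 0 : ℂ) * τ + (γ.1 1 1 : ℂ)))
        = ((γ.1 1 0 : ℂ) * τ + (γ.1 1 1 : ℂ)) ^ (2 - 2 * k) * g τ)
    (hvan : ∀ n : ℤ, n < -(N : ℤ) → c n = 0)
    (hsum : ∀ τ ∈ UHP, HasSum (fun n : ℤ => c n * _root_.e ((n : ℂ) * τ)) (g τ))
    (hint : ∀ m : ℕ, 1 ≤ m → ∃ z : ℤ, c (-(m : ℤ)) = (z : ℂ)) :
    ∀ n : ℤ, ∃ z : ℤ, c n = (z : ℂ) := by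
  let gh : ℍ → ℂ := fun τ => g τ
  let qN : ℍ → ℂ := fun τ => Function.Periodic.qParam 1 τ ^ N
  let f1 : ℍ → ℂ := qN * gh
  let DN := (CuspForm.discriminant.toModularFormₗ).pow N
  -- power series
  have hqN : ∀ τ : ℍ, HasSum (fun m : ℕ ↦ (if m = N then (1 : ℂ) else 0) •
      Function.Periodic.qParam 1 τ ^ m) (qN τ) := by
    intro τ
    convert hasSum_ite_eq N (Function.Periodic.qParam 1 (τ : ℂ) ^ N) using 1
    funext m
    split_ifs with h
    · simp [h]
    · simp
  have hf1 : ∀ τ : ℍ, HasSum (fun m : ℕ ↦ c ((m : ℤ) - N) • Function.Periodic.qParam 1 τ ^ m)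
      (f1 τ) := by
    intro τ
    have h := hsum τ τ.im_pos
    have hinj : Function.Injective (fun m : ℕ => (m : ℤ) - N) := fun a b hab => by
      simpa using hab
    rw [← hinj.hasSum_iff] at h
    · have h' := h.mul_left (qN τ)
      refine (congrArg (fun F : ℕ → ℂ => HasSum F (f1 τ)) ?_).mpr h'
      funext m
      simp only [Function.comp_apply, qN, _root_.e, Function.Periodic.qParam, smul_eq_mul,
        ← Complex.exp_nat_mul]
      rw [mul_left_comm, ← Complex.exp_add]
      congr 2
      push_cast
      ring
    · intro x hx
      rw [hvan x, zero_mul]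
      by_contra hlt
      exact hx ⟨(x + N).toNat, by simp; omega⟩
  -- holomorphy
  have dgh : MDiff gh := by
    rw [UpperHalfPlane.mdifferentiable_iff]
    exact hg.congr fun z hz => by simp [gh, ofComplex_apply_of_im_pos hz]
  have dqN : MDiff qN := by
    rw [UpperHalfPlane.mdifferentiable_iff]
    refine DifferentiableOn.congr (f := fun z => Function.Periodic.qParam 1 z ^ N) ?_
      fun z hz => by simp [qN, ofComplex_apply_of_im_pos hz]
    unfold Function.Periodic.qParam
    fun_prop
  have df1 : MDiff f1 := dqN.mul dgh
  -- invariance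
  have hslash : ∀ γ : SL(2, ℤ), gh ∣[2 - 2 * k] γ = gh := by
    intro γ
    ext τ
    rw [SL_slash_apply]
    have h := htrans γ τ τ.im_pos
    have h1 : ((γ • τ : ℍ) : ℂ) = ((γ.1 0 0 : ℂ) * τ + (γ.1 0 1 : ℂ)) /
        ((γ.1 1 0 : ℂ) * τ + (γ.1 1 1 : ℂ)) := by
      rw [coe_specialLinearGroup_apply]; simp
    have h2 : denom γ τ = (γ.1 1 0 : ℂ) * τ + (γ.1 1 1 : ℂ) := ModularGroup.denom_apply γ τ
    simp only [gh, h1, h]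
    rw [← h2, zpow_neg]
    have h3 := zpow_ne_zero (2 - 2 * k) (denom_ne_zero (γ : GL (Fin 2) ℝ) τ)
    field_simp
  have hslashG : ∀ γ : SL(2, ℤ), (gh * ⇑DN) ∣[(2 - 2 * k) + (N : ℤ) * 12] γ = gh * ⇑DN := by
    intro γ
    rw [mul_slash_SL2, hslash]
    congr 1
    exact SlashInvariantForm.slash_action_eqn DN _ ⟨γ, rfl⟩
  have hbdd : IsBoundedAtImInfty (gh * ⇑DN) := by
    have b1 := isBoundedAtImInfty_of_hasSum_qExpansion one_pos hf1
    have b2 : IsBoundedAtImInfty (fun τ : ℍ => (∏' n, (1 - eta_q n τ) ^ 24) ^ N) :=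
      (tendsto_atImInfty_tprod_one_sub_eta_q_pow.pow N).isBigO_one ℝ
    have : gh * ⇑DN = f1 * (fun τ : ℍ => (∏' n, (1 - eta_q n τ) ^ 24) ^ N) := by
      ext τ
      have hD : DN τ = ModularForm.discriminant τ ^ N := by
        simp only [DN, ModularForm.coe_pow]; rfl
      simp only [Pi.mul_apply, f1, qN, hD, discriminant_eq_q_prod, mul_pow]
      ring
    rw [this]
    exact b1.mul b2
  let G : ModularForm 𝒮ℒ ((2 - 2 * k) + (N : ℤ) * 12) :=
    { toFun := gh * ⇑DN
      slash_action_eq' := fun _ ⟨γ, hγ⟩ ↦ hγ ▸ hslashG γ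
      holo' := dgh.mul DN.holo'
      bdd_at_cusps' := by
        intro x hx
        rw [Subgroup.IsArithmetic.isCusp_iff_isCusp_SL2Z] at hx
        rw [OnePoint.isBoundedAt_iff_forall_SL2Z hx]
        intro γ _
        rw [hslashG γ]
        exact hbdd }
  -- q-expansions
  obtain ⟨U, V, hU, hV, hUV, hD⟩ := delta_unit
  have eqN : qExpansion 1 qN = PowerSeries.X ^ N := by
    rw [qExpansion_of_hasSum hqN dqN]
    ext m
    simp [PowerSeries.coeff_X_pow]
  have ef1 := qExpansion_of_hasSum hf1 df1
  have eDN : qExpansion 1 DN = PowerSeries.X ^ N * U ^ N := by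
    rw [ModularForm.qExpansion_pow one_pos one_mem_strictPeriods_SL, ← mul_pow, ← hD]
    rfl
  have hfun : qN * ⇑G = f1 * ⇑DN := by
    change qN * (gh * ⇑DN) = qN * gh * ⇑DN
    ring
  have hq := congrArg (qExpansion 1) hfun
  rw [qExpansion_mul (analytic_of_hasSum hqN dqN)
      (ModularFormClass.analyticAt_cuspFunction_zero G one_pos one_mem_strictPeriods_SL),
    qExpansion_mul (analytic_of_hasSum hf1 df1)
      (ModularFormClass.analyticAt_cuspFunction_zero DN one_pos one_mem_strictPeriods_SL),
    eqN, ef1, eDN, mul_left_comm] at hq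
  have hG := mul_left_cancel₀ (pow_ne_zero N PowerSeries.X_ne_zero) hq
  set P : PowerSeries ℂ := PowerSeries.mk fun m : ℕ => c ((m : ℤ) - N)
  have hP : IntTo N P := by
    intro m hm
    obtain ⟨z, hz⟩ := hint (N - m) (by omega)
    refine ⟨z, ?_⟩
    rw [← hz, PowerSeries.coeff_mk]
    congr 1
    omega
  have hGi : qExpansion 1 G ∈ IntPS := by
    refine main_ind N _ ?_ ?_ G ?_
    · exact ⟨1 - k + N * 6, by ring⟩
    · omega
    · rw [hG]
      exact hP.mul (IntPS.intTo (pow_mem hU N) N)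
  have hPi : P ∈ IntPS := by
    have : P = qExpansion 1 G * V ^ N := by
      rw [hG, mul_assoc, ← mul_pow, hUV, one_pow, mul_one]
    rw [this]
    exact mul_mem hGi (pow_mem hV N)
  intro n
  by_cases hn : n < -(N : ℤ)
  · exact ⟨0, by simp [hvan n hn]⟩
  · obtain ⟨z, hz⟩ := mem_IntPS.1 hPi (n + N).toNat
    refine ⟨z, ?_⟩
    rw [← hz, PowerSeries.coeff_mk]
    congr 1
    omega

end Helpers

/-- if a weakly holomorphic modular form `g` of weight `2 − 2k` (`k > 1`)
for `SL₂(ℤ)`, with Fourier expansion `g(τ) = Σ_{n ≥ −N} c(n) e(nτ)`, has integral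
principal part (`c(−m) ∈ ℤ` for all `m ≥ 1`), then all its Fourier coefficients
are integers. -/
theorem stmt2 (k : ℤ) (hk : 1 < k) (g : ℂ → ℂ) (N : ℕ) (c : ℤ → ℂ)
    (hg : DifferentiableOn ℂ g UHP)
    (htrans : ∀ γ : Matrix.SpecialLinearGroup (Fin 2) ℤ, ∀ τ ∈ UHP,
      g (((γ.1 0 0 : ℂ) * τ + (γ.1 0 1 : ℂ)) / ((γ.1 1 0 : ℂ) * τ + (γ.1 1 1 : ℂ)))
        = ((γ.1 1 0 : ℂ) * τ + (γ.1 1 1 : ℂ)) ^ (2 - 2 * k) * g τ)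
    (hvan : ∀ n : ℤ, n < -(N : ℤ) → c n = 0)
    (hsum : ∀ τ ∈ UHP, HasSum (fun n : ℤ => c n * e ((n : ℂ) * τ)) (g τ))
    (hint : ∀ m : ℕ, 1 ≤ m → ∃ z : ℤ, c (-(m : ℤ)) = (z : ℂ)) :
    ∀ n : ℤ, ∃ z : ℤ, c n = (z : ℂ) := by
  exact stmt2_aux k hk g N c hg htrans hvan hsum hint
end
end

section
/- Define Θ : ℍ × ℍ × ℍ → ℂ by Θ(τ; τ₁, τ₂) = Im(τ) · Σ_{a,b,c,d ∈ ℤ} e( ( τ·|aτ₁τ₂ + bτ₁ + cτ₂ + d|² − τ̄·|aτ₁τ̄₂ + bτ₁ + cτ̄₂ + d|² ) / (4·Im(τ₁)·Im(τ₂)) ), the series converging absolutely and locally uniformly together with all its partial derivatives. For a variable z = u + iv ranging over ℍ let Δ^z := −v²(∂²/∂u² + ∂²/∂v²) denote the weight-0 hyperbolic Laplacian in z. Then Δ^τ Θ = Δ^{τ₁} Θ = Δ^{τ₂} Θ as functions on ℍ × ℍ × ℍ. -/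
noncomputable section

open Complex Real

/-- The Siegel theta function of the lattice `M₂(ℤ)` attached to the point of the
Grassmannian corresponding to `(τ₁, τ₂)`:
`Θ(τ; τ₁, τ₂) = Im τ · Σ_{a,b,c,d ∈ ℤ} e((τ|aτ₁τ₂+bτ₁+cτ₂+d|² − τ̄|aτ₁τ̄₂+bτ₁+cτ̄₂+d|²)/(4 Im τ₁ Im τ₂))`. -/
def Theta (τ τ₁ τ₂ : ℂ) : ℂ :=
  (τ.im : ℂ) * ∑' v : (ℤ × ℤ) × (ℤ × ℤ),
    e ((τ * ((Complex.normSq ((v.1.1 : ℂ) * τ₁ * τ₂ + (v.1.2 : ℂ) * τ₁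
            + (v.2.1 : ℂ) * τ₂ + (v.2.2 : ℂ)) : ℝ) : ℂ)
        - (starRingEnd ℂ) τ *
            ((Complex.normSq ((v.1.1 : ℂ) * τ₁ * (starRingEnd ℂ) τ₂ + (v.1.2 : ℂ) * τ₁
              + (v.2.1 : ℂ) * (starRingEnd ℂ) τ₂ + (v.2.2 : ℂ)) : ℝ) : ℂ))
      / (4 * (τ₁.im : ℂ) * (τ₂.im : ℂ)))

/-- The weight-0 hyperbolic Laplacian `Δ = −v²(∂²/∂u² + ∂²/∂v²)` at `z = u + iv`. -/
def lap (f : ℂ → ℂ) (z : ℂ) : ℂ :=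
  -(z.im : ℂ) ^ 2 *
    (fderiv ℝ (fun w => fderiv ℝ f w 1) z 1 + fderiv ℝ (fun w => fderiv ℝ f w I) z I)


set_option linter.unusedSectionVars false
section abs
variable {ι E : Type} [NormedAddCommGroup E] [NormedSpace ℝ E]

def Good (L : ι → E →L[ℝ] ℂ) (q : ι → ℝ) : Set E :=
  {x | ∃ δ > 0, ∃ C : ℝ, ∀ v, (L v x).re ≤ C - δ * q v}

lemma good_ball {L : ι → E →L[ℝ] ℂ} {q : ι → ℝ} (hL : ∀ v, ‖L v‖ ≤ q v) {x₀ : E}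
    (h : x₀ ∈ Good L q) :
    ∃ δ > 0, ∃ C : ℝ, ∀ x ∈ Metric.ball x₀ δ, ∀ v, (L v x).re ≤ C - δ * q v := by
  obtain ⟨δ, hδ, C, hC⟩ := h
  refine ⟨δ / 2, by positivity, C, fun x hx v => ?_⟩
  have h1 : (L v x).re = (L v x₀).re + (L v (x - x₀)).re := by
    rw [map_sub, Complex.sub_re]; ring
  have h2 : (L v (x - x₀)).re ≤ q v * (δ / 2) := by
    refine (Complex.re_le_norm _).trans (((L v).le_opNorm _).trans ?_)
    have : ‖x - x₀‖ ≤ δ / 2 := by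
      rw [← dist_eq_norm]; exact (Metric.mem_ball.1 hx).le
    exact mul_le_mul (hL v) this (norm_nonneg _) ((norm_nonneg _).trans (hL v))
  have := hC v
  rw [h1]; linarith

lemma isOpen_good {L : ι → E →L[ℝ] ℂ} {q : ι → ℝ} (hL : ∀ v, ‖L v‖ ≤ q v) :
    IsOpen (Good L q) := by
  rw [Metric.isOpen_iff]
  intro x hx
  obtain ⟨δ, hδ, C, h⟩ := good_ball hL hx
  exact ⟨δ, hδ, fun y hy => ⟨δ, hδ, C, h y hy⟩⟩

lemma summable_bound {q : ι → ℝ} (hq : ∀ v, 0 ≤ q v)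
    (hs : ∀ c > 0, Summable fun v => Real.exp (-(c * q v))) (K C δ : ℝ) (hδ : 0 < δ) (k : ℕ) :
    Summable fun v => Real.exp (C - δ * q v) * (K * q v ^ k) := by
  have h1 : Summable fun v => Real.exp (-(δ / 2 * q v)) * (|K| * Real.exp C * (k.factorial / (δ / 2) ^ k)) :=
    (hs (δ / 2) (by positivity)).mul_right _
  refine Summable.of_norm_bounded h1 fun v => ?_
  rw [norm_mul, norm_mul, Real.norm_eq_abs, Real.norm_eq_abs, Real.norm_eq_abs, Real.abs_exp,
    abs_of_nonneg (pow_nonneg (hq v) k)]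
  have h2 := Real.pow_div_factorial_le_exp (δ / 2 * q v) (by have := hq v; positivity) k
  have h3 : q v ^ k ≤ (k.factorial / (δ / 2) ^ k) * Real.exp (δ / 2 * q v) := by
    rw [mul_pow] at h2
    have : (0:ℝ) < k.factorial := by positivity
    have h4 : 0 < (δ / 2) ^ k := by positivity
    rw [div_le_iff₀ this] at h2
    rw [div_mul_eq_mul_div, le_div_iff₀ h4]
    linarith
  have h5 : Real.exp (C - δ * q v) = Real.exp C * (Real.exp (-(δ / 2 * q v)) * Real.exp (-(δ / 2 * q v))) := by
    rw [← Real.exp_add, ← Real.exp_add]; congr 1; ring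
  have h6 : Real.exp (-(δ / 2 * q v)) * Real.exp (δ / 2 * q v) = 1 := by
    rw [← Real.exp_add]; simp
  calc Real.exp (C - δ * q v) * (|K| * q v ^ k)
      ≤ Real.exp (C - δ * q v) * (|K| * ((k.factorial / (δ / 2) ^ k) * Real.exp (δ / 2 * q v))) := by
        gcongr
    _ = _ := by
        rw [h5]
        linear_combination (Real.exp (-(δ / 2 * q v)) * (|K| * Real.exp C * (k.factorial / (δ / 2) ^ k))) * h6

variable {F : Type} [NormedAddCommGroup F] [NormedSpace ℝ F] [NormedSpace ℂ F]
  [IsScalarTower ℝ ℂ F] [CompleteSpace F]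

noncomputable def G (L : ι → E →L[ℝ] ℂ) (c : ι → F) (x : E) : F := ∑' v, Complex.exp (L v x) • c v

lemma summable_G {L : ι → E →L[ℝ] ℂ} {q : ι → ℝ} (hL : ∀ v, ‖L v‖ ≤ q v)
    (hs : ∀ c > 0, Summable fun v => Real.exp (-(c * q v))) {c : ι → F} {K : ℝ} {k : ℕ}
    (hc : ∀ v, ‖c v‖ ≤ K * q v ^ k) {x : E} (hx : x ∈ Good L q) :
    Summable fun v => ‖Complex.exp (L v x) • c v‖ := by
  obtain ⟨δ, hδ, C, h⟩ := hx
  refine Summable.of_nonneg_of_le (fun _ => norm_nonneg _) (fun v => ?_)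
    (summable_bound (fun v => (norm_nonneg _).trans (hL v)) hs K C δ hδ k)
  rw [norm_smul, Complex.norm_exp]
  exact mul_le_mul (Real.exp_le_exp.2 (h v)) (hc v) (norm_nonneg _) (Real.exp_pos _).le

lemma bound_smulRight {L : ι → E →L[ℝ] ℂ} {q : ι → ℝ} (hL : ∀ v, ‖L v‖ ≤ q v)
    {c : ι → F} {K : ℝ} {k : ℕ}
    (hc : ∀ v, ‖c v‖ ≤ K * q v ^ k) (v : ι) : ‖(L v).smulRight (c v)‖ ≤ K * q v ^ (k + 1) := by
  have h1 : ‖L v‖ * ‖c v‖ ≤ K * q v ^ (k + 1) := by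
    calc ‖L v‖ * ‖c v‖ ≤ q v * (K * q v ^ k) :=
          mul_le_mul (hL v) (hc v) (norm_nonneg _) ((norm_nonneg _).trans (hL v))
      _ = _ := by ring
  refine (ContinuousLinearMap.opNorm_le_bound _ (by positivity) fun x => ?_).trans h1
  rw [ContinuousLinearMap.smulRight_apply, norm_smul]
  calc ‖L v x‖ * ‖c v‖ ≤ (‖L v‖ * ‖x‖) * ‖c v‖ := by gcongr; exact (L v).le_opNorm x
    _ = _ := by ring

lemma hasFDerivAt_term (l : E →L[ℝ] ℂ) (c : F) (y : E) :
    HasFDerivAt (fun y => Complex.exp (l y) • c) (Complex.exp (l y) • l.smulRight c) y := by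
  have := (l.hasFDerivAt (x := y)).cexp.smul_const c
  refine this.congr_fderiv ?_
  ext z
  simp [mul_smul]

lemma hasFDerivAt_G {L : ι → E →L[ℝ] ℂ} {q : ι → ℝ} (hL : ∀ v, ‖L v‖ ≤ q v)
    (hs : ∀ c > 0, Summable fun v => Real.exp (-(c * q v))) {c : ι → F} {K : ℝ} {k : ℕ}
    (hc : ∀ v, ‖c v‖ ≤ K * q v ^ k) {x : E} (hx : x ∈ Good L q) :
    HasFDerivAt (G L c) (G L (fun v => (L v).smulRight (c v)) x) x := by
  obtain ⟨δ, hδ, C, h⟩ := good_ball hL hx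
  have hb : ∀ v, ∀ y ∈ Metric.ball x δ, ‖Complex.exp (L v y) • (L v).smulRight (c v)‖ ≤
      Real.exp (C - δ * q v) * (K * q v ^ (k + 1)) := by
    intro v y hy
    rw [norm_smul, Complex.norm_exp]
    exact mul_le_mul (Real.exp_le_exp.2 (h y hy v)) (bound_smulRight hL hc v) (norm_nonneg _)
      (Real.exp_pos _).le
  have key := hasFDerivAt_tsum_of_isPreconnected (𝕜 := ℝ)
    (f := fun v (y : E) => Complex.exp (L v y) • c v)
    (f' := fun v (y : E) => Complex.exp (L v y) • (L v).smulRight (c v))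
    (summable_bound (fun v => (norm_nonneg _).trans (hL v)) hs K C δ hδ (k + 1))
    Metric.isOpen_ball (convex_ball x δ).isPreconnected
    (fun v y _ => hasFDerivAt_term (L v) (c v) y) hb
    (Metric.mem_ball_self hδ) (summable_G hL hs hc hx).of_norm (Metric.mem_ball_self hδ)
  exact key

end abs

lemma contDiffOn_G {ι E : Type} [NormedAddCommGroup E] [NormedSpace ℝ E]
    {L : ι → E →L[ℝ] ℂ} {q : ι → ℝ} (hL : ∀ v, ‖L v‖ ≤ q v)
    (hs : ∀ c > 0, Summable fun v => Real.exp (-(c * q v))) (n : ℕ) :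
    ∀ {F : Type} [NormedAddCommGroup F] [NormedSpace ℝ F] [NormedSpace ℂ F]
      [IsScalarTower ℝ ℂ F] [CompleteSpace F] {c : ι → F} {K : ℝ} {k : ℕ}
      (_ : ∀ v, ‖c v‖ ≤ K * q v ^ k), ContDiffOn ℝ n (G L c) (Good L q) := by
  induction n with
  | zero =>
    intro F _ _ _ _ _ c K k hc
    rw [Nat.cast_zero, contDiffOn_zero]
    exact fun x hx => (hasFDerivAt_G hL hs hc hx).continuousAt.continuousWithinAt
  | succ n ih =>
    intro F _ _ _ _ _ c K k hc
    rw [Nat.cast_succ, contDiffOn_succ_iff_fderiv_of_isOpen (isOpen_good hL)]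
    refine ⟨fun x hx => (hasFDerivAt_G hL hs hc hx).differentiableAt.differentiableWithinAt,
      by simp, ?_⟩
    refine (ih (bound_smulRight hL hc)).congr fun x hx => (hasFDerivAt_G hL hs hc hx).fderiv

lemma hasSum_of_eq {ι : Type} {f g : ι → ℂ} {S : ℂ} (h : HasSum f S) (hg : ∀ v, g v = f v) :
    HasSum g S := by
  have : g = f := funext hg
  rw [this]; exact h

/-- second derivative along a curve -/
lemma hasDerivAt2_G {ι E : Type} [NormedAddCommGroup E] [NormedSpace ℝ E]
    {L : ι → E →L[ℝ] ℂ} {q : ι → ℝ} (hL : ∀ v, ‖L v‖ ≤ q v)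
    (hs : ∀ c > 0, Summable fun v => Real.exp (-(c * q v)))
    (γ γ₁ : ℝ → E) (γ₂ : E) (h1 : ∀ᶠ t in nhds 0, HasDerivAt γ (γ₁ t) t)
    (h2 : HasDerivAt γ₁ γ₂ 0) (hg : γ 0 ∈ Good L q) :
    ∃ S : ℂ, HasSum (fun v => Complex.exp (L v (γ 0)) * (L v (γ₁ 0) * L v (γ₁ 0) + L v γ₂)) S ∧
      deriv (deriv (fun t => G L (fun _ => (1:ℂ)) (γ t))) 0 = S := by
  have hc0 : ∀ v : ι, ‖(1:ℂ)‖ ≤ 1 * q v ^ 0 := by simp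
  have hc1 := bound_smulRight hL hc0
  have hc2 := bound_smulRight hL hc1
  have hγ : ContinuousAt γ 0 := h1.self_of_nhds.continuousAt
  have hev : ∀ᶠ t in nhds 0, γ t ∈ Good L q := hγ.eventually ((isOpen_good hL).mem_nhds hg)
  have hd : deriv (fun t => G L (fun _ => (1:ℂ)) (γ t)) =ᶠ[nhds 0]
      fun t => G L (fun v => (L v).smulRight (1:ℂ)) (γ t) (γ₁ t) := by
    filter_upwards [h1, hev] with t ht1 ht2
    exact ((hasFDerivAt_G hL hs hc0 ht2).comp_hasDerivAt t ht1).deriv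
  have hd2 := (((hasFDerivAt_G hL hs hc1 hg).comp_hasDerivAt 0 h1.self_of_nhds).clm_apply h2).deriv
  refine ⟨_, ?_, hd.deriv_eq.trans hd2⟩
  have s1 := (summable_G hL hs hc1 hg).of_norm.hasSum
  have s2 := (summable_G hL hs hc2 hg).of_norm.hasSum
  have t1 := s1.mapL (ContinuousLinearMap.apply ℝ ℂ γ₂)
  have t2 := (s2.mapL (ContinuousLinearMap.apply ℝ _ (γ₁ 0))).mapL (ContinuousLinearMap.apply ℝ ℂ (γ₁ 0))
  refine hasSum_of_eq (t2.add t1) fun v => ?_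
  simp
  ring

lemma second_dir {f : ℂ → ℂ} {z : ℂ} (hf : ContDiffAt ℝ 2 f z) (d : ℂ) :
    fderiv ℝ (fun w => fderiv ℝ f w d) z d = deriv (deriv (fun t : ℝ => f (z + t * d))) 0 := by
  have hline : ∀ t : ℝ, HasDerivAt (fun t : ℝ => z + t * d) d t := by
    intro t
    simpa using ((Complex.ofRealCLM.hasDerivAt (x := t)).mul_const d).const_add z
  have h0 : z + ((0:ℝ):ℂ) * d = z := by simp
  have hev : ∀ᶠ w in nhds z, DifferentiableAt ℝ f w := by
    have := hf.eventually (by simp)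
    exact this.mono fun w hw => hw.differentiableAt (by simp)
  have hcont : Filter.Tendsto (fun t : ℝ => z + t * d) (nhds 0) (nhds z) := by
    have := (hline 0).continuousAt.tendsto
    rwa [h0] at this
  have h1 : deriv (fun t : ℝ => f (z + t * d)) =ᶠ[nhds 0] fun t => fderiv ℝ f (z + t * d) d := by
    filter_upwards [hcont.eventually hev] with t ht
    exact (ht.hasFDerivAt.comp_hasDerivAt t (hline t)).deriv
  rw [h1.deriv_eq]
  have h2 : DifferentiableAt ℝ (fun w => fderiv ℝ f w d) z := by
    have : DifferentiableAt ℝ (fderiv ℝ f) z :=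
      (hf.fderiv_right (m := 1) (by norm_num)).differentiableAt (by simp)
    exact this.clm_apply (differentiableAt_const d)
  have h3 : HasFDerivAt (fun w => fderiv ℝ f w d) (fderiv ℝ (fun w => fderiv ℝ f w d) z)
      (z + ((0:ℝ):ℂ) * d) := by rw [h0]; exact h2.hasFDerivAt
  exact ((h3.comp_hasDerivAt (0:ℝ) (hline 0)).deriv).symm

abbrev Idx := (ℤ × ℤ) × (ℤ × ℤ)

lemma summable_Z (c : ℝ) (hc : 0 < c) : Summable fun n : ℤ => Real.exp (-(c * (n:ℝ)^2)) := by
  have h := Real.summable_exp_nat_mul_iff.2 (neg_lt_zero.2 hc)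
  have h2 : Summable fun n : ℕ => Real.exp (-(c * (n:ℝ)^2)) := by
    refine Summable.of_nonneg_of_le (fun _ => (Real.exp_pos _).le) (fun n => ?_) h
    apply Real.exp_le_exp.2
    have : (n:ℝ) ≤ (n:ℝ)^2 := by
      have : n ≤ n^2 := Nat.le_self_pow (by norm_num) n
      exact_mod_cast this
    nlinarith
  refine Summable.of_nat_of_neg ?_ ?_
  · simpa using h2
  · simpa using h2

def N (v : Idx) : ℝ := 1 + (v.1.1:ℝ)^2 + (v.1.2:ℝ)^2 + (v.2.1:ℝ)^2 + (v.2.2:ℝ)^2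

lemma summable_N (c : ℝ) (hc : 0 < c) : Summable fun v : Idx => Real.exp (-(c * (77 * N v))) := by
  have h := summable_Z (c * 77) (by positivity)
  have h2 := h.mul_of_nonneg h (fun _ => (Real.exp_pos _).le) (fun _ => (Real.exp_pos _).le)
  have h4 := h2.mul_of_nonneg h2 (fun _ => by simp only [Pi.zero_apply]; positivity)
    (fun _ => by simp only [Pi.zero_apply]; positivity)
  refine (h4.mul_left (Real.exp (-(c * 77)))).congr fun v => ?_
  rw [← Real.exp_add, ← Real.exp_add, ← Real.exp_add, ← Real.exp_add]
  congr 1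
  unfold N
  ring

def mc (v : Idx) : Fin 11 → ℂ :=
  ![1, -2 * π * I * (v.1.1 * v.2.2 - v.1.2 * v.2.1), -π * v.1.1 ^ 2, -2 * π * (v.1.1 * v.2.1),
    -π * v.2.1 ^ 2, -π * v.1.2 ^ 2, -2 * π * (v.1.2 * v.2.2), -π * v.2.2 ^ 2,
    -2 * π * (v.1.1 * v.1.2), -2 * π * (v.1.1 * v.2.2 + v.1.2 * v.2.1),
    -2 * π * (v.2.1 * v.2.2)]

def Psi (l u v a1 b1 c1 a2 b2 c2 : ℝ) : Fin 11 → ℝ :=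
  ![l, u, v * (a1 * a2), v * (b1 * a2), v * (c1 * a2), v * (a1 * c2), v * (b1 * c2),
    v * (c1 * c2), v * (a1 * b2), v * (b1 * b2), v * (c1 * b2)]

def Lc (v : Idx) : (Fin 11 → ℝ) →L[ℝ] ℂ :=
  ∑ k, (ContinuousLinearMap.proj (R := ℝ) (φ := fun _ : Fin 11 => ℝ) k).smulRight (mc v k)

lemma Lc_apply (v : Idx) (x : Fin 11 → ℝ) : Lc v x = ∑ k, (x k : ℂ) * mc v k := by
  simp [Lc]

set_option maxHeartbeats 1000000 in
lemma norm_mc (v : Idx) (k : Fin 11) : ‖mc v k‖ ≤ 7 * N v := by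
  obtain ⟨⟨a, b⟩, ⟨c, d⟩⟩ := v
  have hπ : π ≤ 3.5 := by linarith [Real.pi_lt_d2]
  have hπ0 := Real.pi_pos
  have key : ∀ r : ℝ, |r| ≤ N ((a, b), (c, d)) → 2 * π * |r| ≤ 7 * N ((a, b), (c, d)) := by
    intro r hr
    have := abs_nonneg r
    nlinarith
  have hA := sq_nonneg (a:ℝ)
  have hB := sq_nonneg (b:ℝ)
  have hC := sq_nonneg (c:ℝ)
  have hD := sq_nonneg (d:ℝ)
  have k1 : ∀ (w : ℂ) (r s : ℝ), ‖w‖ = s * |r| → s ≤ 2 * π → |r| ≤ N ((a, b), (c, d)) →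
      ‖w‖ ≤ 7 * N ((a, b), (c, d)) := by
    intro w r s hw hs hr
    have := key r hr
    have := abs_nonneg r
    rw [hw]
    nlinarith
  have e1 : ∀ r : ℝ, ‖(-(π:ℂ)) * (r:ℂ)‖ = π * |r| := by
    intro r; rw [norm_mul, norm_neg, Complex.norm_real, Complex.norm_real, Real.norm_eq_abs, Real.norm_eq_abs, abs_of_pos hπ0]
  have e2 : ∀ r : ℝ, ‖(-2 * (π:ℂ)) * (r:ℂ)‖ = 2 * π * |r| := by
    intro r; rw [norm_mul, norm_mul, norm_neg, Complex.norm_real, Complex.norm_real, Real.norm_eq_abs, Real.norm_eq_abs, abs_of_pos hπ0]; simp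
  have e3 : ∀ r : ℝ, ‖(-2 * (π:ℂ) * I) * (r:ℂ)‖ = 2 * π * |r| := by
    intro r; rw [norm_mul, norm_mul, norm_mul, norm_neg, Complex.norm_real, Complex.norm_real, Real.norm_eq_abs, Real.norm_eq_abs, abs_of_pos hπ0]; simp
  have hs : π ≤ 2 * π := by linarith
  have p1 := sq_nonneg ((a:ℝ) - b)
  have p2 := sq_nonneg ((a:ℝ) - c)
  have p3 := sq_nonneg ((a:ℝ) - d)
  have p4 := sq_nonneg ((b:ℝ) - c)
  have p5 := sq_nonneg ((b:ℝ) - d)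
  have p6 := sq_nonneg ((c:ℝ) - d)
  have n1 := sq_nonneg ((a:ℝ) + b)
  have n2 := sq_nonneg ((a:ℝ) + c)
  have n3 := sq_nonneg ((a:ℝ) + d)
  have n4 := sq_nonneg ((b:ℝ) + c)
  have n5 := sq_nonneg ((b:ℝ) + d)
  have n6 := sq_nonneg ((c:ℝ) + d)
  have f0 : ‖mc ((a, b), (c, d)) 0‖ ≤ 7 * N ((a, b), (c, d)) := by
    simp only [mc, N]; simp; linarith
  have f1 : ‖mc ((a, b), (c, d)) 1‖ ≤ 7 * N ((a, b), (c, d)) :=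
    k1 _ (a * d - b * c) _ (by rw [← e3]; simp [mc]) le_rfl
      (abs_le.2 ⟨by simp only [N]; linarith, by simp only [N]; linarith⟩)
  have f2 : ‖mc ((a, b), (c, d)) 2‖ ≤ 7 * N ((a, b), (c, d)) :=
    k1 _ (a ^ 2) _ (by rw [← e1]; simp [mc]) hs
      (abs_le.2 ⟨by simp only [N]; linarith, by simp only [N]; linarith⟩)
  have f3 : ‖mc ((a, b), (c, d)) 3‖ ≤ 7 * N ((a, b), (c, d)) :=
    k1 _ (a * c) _ (by rw [← e2]; simp [mc]) le_rfl
      (abs_le.2 ⟨by simp only [N]; linarith, by simp only [N]; linarith⟩)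
  have f4 : ‖mc ((a, b), (c, d)) 4‖ ≤ 7 * N ((a, b), (c, d)) :=
    k1 _ (c ^ 2) _ (by rw [← e1]; simp [mc]) hs
      (abs_le.2 ⟨by simp only [N]; linarith, by simp only [N]; linarith⟩)
  have f5 : ‖mc ((a, b), (c, d)) 5‖ ≤ 7 * N ((a, b), (c, d)) :=
    k1 _ (b ^ 2) _ (by rw [← e1]; simp [mc]) hs
      (abs_le.2 ⟨by simp only [N]; linarith, by simp only [N]; linarith⟩)
  have f6 : ‖mc ((a, b), (c, d)) 6‖ ≤ 7 * N ((a, b), (c, d)) :=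
    k1 _ (b * d) _ (by rw [← e2]; simp [mc]) le_rfl
      (abs_le.2 ⟨by simp only [N]; linarith, by simp only [N]; linarith⟩)
  have f7 : ‖mc ((a, b), (c, d)) 7‖ ≤ 7 * N ((a, b), (c, d)) :=
    k1 _ (d ^ 2) _ (by rw [← e1]; simp [mc]) hs
      (abs_le.2 ⟨by simp only [N]; linarith, by simp only [N]; linarith⟩)
  have f8 : ‖mc ((a, b), (c, d)) 8‖ ≤ 7 * N ((a, b), (c, d)) :=
    k1 _ (a * b) _ (by rw [← e2]; simp [mc]) le_rfl
      (abs_le.2 ⟨by simp only [N]; linarith, by simp only [N]; linarith⟩)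
  have f9 : ‖mc ((a, b), (c, d)) 9‖ ≤ 7 * N ((a, b), (c, d)) :=
    k1 _ (a * d + b * c) _ (by rw [← e2]; simp [mc]) le_rfl
      (abs_le.2 ⟨by simp only [N]; linarith, by simp only [N]; linarith⟩)
  have f10 : ‖mc ((a, b), (c, d)) 10‖ ≤ 7 * N ((a, b), (c, d)) :=
    k1 _ (c * d) _ (by rw [← e2]; simp [mc]) le_rfl
      (abs_le.2 ⟨by simp only [N]; linarith, by simp only [N]; linarith⟩)
  fin_cases k
  · exact f0
  · exact f1
  · exact f2
  · exact f3
  · exact f4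
  · exact f5
  · exact f6
  · exact f7
  · exact f8
  · exact f9
  · exact f10

lemma norm_Lc (v : Idx) : ‖Lc v‖ ≤ 77 * N v := by
  have hN : 0 ≤ N v := by unfold N; positivity
  refine ContinuousLinearMap.opNorm_le_bound _ (by positivity) fun x => ?_
  rw [Lc_apply]
  calc ‖∑ k, (x k : ℂ) * mc v k‖ ≤ ∑ k : Fin 11, ‖x‖ * (7 * N v) := by
        refine norm_sum_le_of_le _ fun k _ => ?_
        rw [norm_mul, Complex.norm_real]
        exact mul_le_mul (norm_le_pi_norm x k) (norm_mc v k) (norm_nonneg _) (norm_nonneg _)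
    _ = _ := by simp; ring

lemma Lc_Psi (w : Idx) (l u v a1 b1 c1 a2 b2 c2 : ℝ) :
    Lc w (Psi l u v a1 b1 c1 a2 b2 c2) =
      l - 2 * π * I * (w.1.1 * w.2.2 - w.1.2 * w.2.1) * u
      - π * v * (w.1.1 ^ 2 * (a1 * a2) + 2 * (w.1.1 * w.2.1) * (b1 * a2) + w.2.1 ^ 2 * (c1 * a2)
        + w.1.2 ^ 2 * (a1 * c2) + 2 * (w.1.2 * w.2.2) * (b1 * c2) + w.2.2 ^ 2 * (c1 * c2)
        + 2 * (w.1.1 * w.1.2) * (a1 * b2) + 2 * (w.1.1 * w.2.2 + w.1.2 * w.2.1) * (b1 * b2)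
        + 2 * (w.2.1 * w.2.2) * (c1 * b2)) := by
  rw [Lc_apply]
  simp only [Fin.sum_univ_succ, Psi, mc]
  simp
  ring

lemma form_bound {a b c : ℝ} (ha : 0 < a) (hc : 0 < c) (h : a * c - b ^ 2 = 1) (p q : ℝ) :
    (p ^ 2 + q ^ 2) / (a + c) ≤ a * p ^ 2 + 2 * b * (p * q) + c * q ^ 2 := by
  rw [div_le_iff₀ (by positivity)]
  have : (a * p ^ 2 + 2 * b * (p * q) + c * q ^ 2) * (a + c) - (p ^ 2 + q ^ 2)
      = (a * p + b * q) ^ 2 + (b * p + c * q) ^ 2 := by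
    linear_combination (p ^ 2 + q ^ 2) * h
  nlinarith [sq_nonneg (a * p + b * q), sq_nonneg (b * p + c * q)]

lemma good_Psi {l u v a1 b1 c1 a2 b2 c2 : ℝ} (hv : 0 < v) (ha1 : 0 < a1) (hc1 : 0 < c1)
    (h1 : a1 * c1 - b1 ^ 2 = 1) (ha2 : 0 < a2) (hc2 : 0 < c2) (h2 : a2 * c2 - b2 ^ 2 = 1) :
    Psi l u v a1 b1 c1 a2 b2 c2 ∈ Good Lc (fun v => 77 * N v) := by
  have hπ := Real.pi_pos
  refine ⟨π * v / ((a1 + c1) * (a2 + c2)) / 77, by positivity,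
    l + π * v / ((a1 + c1) * (a2 + c2)), fun w => ?_⟩
  have hre : (Lc w (Psi l u v a1 b1 c1 a2 b2 c2)).re = l
      - π * v * (w.1.1 ^ 2 * (a1 * a2) + 2 * (w.1.1 * w.2.1) * (b1 * a2) + w.2.1 ^ 2 * (c1 * a2)
        + w.1.2 ^ 2 * (a1 * c2) + 2 * (w.1.2 * w.2.2) * (b1 * c2) + w.2.2 ^ 2 * (c1 * c2)
        + 2 * (w.1.1 * w.1.2) * (a1 * b2) + 2 * (w.1.1 * w.2.2 + w.1.2 * w.2.1) * (b1 * b2)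
        + 2 * (w.2.1 * w.2.2) * (c1 * b2)) := by
    have : Lc w (Psi l u v a1 b1 c1 a2 b2 c2) = ((l
      - π * v * (w.1.1 ^ 2 * (a1 * a2) + 2 * (w.1.1 * w.2.1) * (b1 * a2) + w.2.1 ^ 2 * (c1 * a2)
        + w.1.2 ^ 2 * (a1 * c2) + 2 * (w.1.2 * w.2.2) * (b1 * c2) + w.2.2 ^ 2 * (c1 * c2)
        + 2 * (w.1.1 * w.1.2) * (a1 * b2) + 2 * (w.1.1 * w.2.2 + w.1.2 * w.2.1) * (b1 * b2)
        + 2 * (w.2.1 * w.2.2) * (c1 * b2)) : ℝ) : ℂ) +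
        ((- 2 * π * (w.1.1 * w.2.2 - w.1.2 * w.2.1) * u : ℝ) : ℂ) * I := by
      rw [Lc_Psi]; push_cast; ring
    rw [this]
    simp only [Complex.add_re, Complex.re_ofReal_mul, Complex.I_re, Complex.ofReal_re, mul_zero, add_zero]
  rw [hre]
  obtain ⟨⟨a', b'⟩, ⟨c', d'⟩⟩ := w
  simp only [N]
  generalize (a' : ℝ) = a
  generalize (b' : ℝ) = b
  generalize (c' : ℝ) = c
  generalize (d' : ℝ) = d
  have i1 := form_bound ha2 hc2 h2 a b
  have i2 := form_bound ha2 hc2 h2 c d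
  have z : ∀ p q : ℝ, 0 ≤ a2 * p ^ 2 + 2 * b2 * (p * q) + c2 * q ^ 2 := fun p q =>
    le_trans (by positivity) (form_bound ha2 hc2 h2 p q)
  have i3 := z (a1 * a + b1 * c) (a1 * b + b1 * d)
  have i4 := z (b1 * a + c1 * c) (b1 * b + c1 * d)
  set S := a ^ 2 * (a1 * a2) + 2 * (a * c) * (b1 * a2) + c ^ 2 * (c1 * a2)
        + b ^ 2 * (a1 * c2) + 2 * (b * d) * (b1 * c2) + d ^ 2 * (c1 * c2)
        + 2 * (a * b) * (a1 * b2) + 2 * (a * d + b * c) * (b1 * b2)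
        + 2 * (c * d) * (c1 * b2) with hS
  have hS2 : S * (a1 + c1) = (a2 * a ^ 2 + 2 * b2 * (a * b) + c2 * b ^ 2)
      + (a2 * c ^ 2 + 2 * b2 * (c * d) + c2 * d ^ 2)
      + (a2 * (a1 * a + b1 * c) ^ 2 + 2 * b2 * ((a1 * a + b1 * c) * (a1 * b + b1 * d)) + c2 * (a1 * b + b1 * d) ^ 2)
      + (a2 * (b1 * a + c1 * c) ^ 2 + 2 * b2 * ((b1 * a + c1 * c) * (b1 * b + c1 * d)) + c2 * (b1 * b + c1 * d) ^ 2) := by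
    rw [hS]
    linear_combination ((a2 * a ^ 2 + 2 * b2 * (a * b) + c2 * b ^ 2)
      + (a2 * c ^ 2 + 2 * b2 * (c * d) + c2 * d ^ 2)) * h1
  have hle : (a ^ 2 + b ^ 2 + c ^ 2 + d ^ 2) / ((a1 + c1) * (a2 + c2)) ≤ S := by
    rw [mul_comm (a1 + c1), ← div_div, div_le_iff₀ (by positivity), hS2]
    have : (a ^ 2 + b ^ 2 + c ^ 2 + d ^ 2) / (a2 + c2) = (a ^ 2 + b ^ 2) / (a2 + c2) + (c ^ 2 + d ^ 2) / (a2 + c2) := by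
      ring
    rw [this]; linarith
  have := mul_le_mul_of_nonneg_left hle (by positivity : 0 ≤ π * v)
  have e : l + π * v / ((a1 + c1) * (a2 + c2)) -
      π * v / ((a1 + c1) * (a2 + c2)) / 77 * (77 * (1 + a ^ 2 + b ^ 2 + c ^ 2 + d ^ 2))
      = l - π * v * ((a ^ 2 + b ^ 2 + c ^ 2 + d ^ 2) / ((a1 + c1) * (a2 + c2))) := by ring
  rw [e]; linarith

def al (x y : ℝ) : ℝ := x ^ 2 / y + y
def be (x y : ℝ) : ℝ := x / y
def ga (y : ℝ) : ℝ := 1 / y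

def Phi (τ τ₁ τ₂ : ℂ) : Fin 11 → ℝ :=
  Psi (Real.log τ.im) τ.re τ.im (al τ₁.re τ₁.im) (be τ₁.re τ₁.im) (ga τ₁.im)
    (al τ₂.re τ₂.im) (be τ₂.re τ₂.im) (ga τ₂.im)

lemma al_pos {x y : ℝ} (hy : 0 < y) : 0 < al x y := by unfold al; positivity
lemma ga_pos {y : ℝ} (hy : 0 < y) : 0 < ga y := by unfold ga; positivity
lemma abc {x y : ℝ} (hy : 0 < y) : al x y * ga y - be x y ^ 2 = 1 := by
  unfold al be ga; field_simp; ring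

lemma good_Phi {τ τ₁ τ₂ : ℂ} (h : 0 < τ.im) (h1 : 0 < τ₁.im) (h2 : 0 < τ₂.im) :
    Phi τ τ₁ τ₂ ∈ Good Lc (fun v => 77 * N v) :=
  good_Psi h (al_pos h1) (ga_pos h1) (abc h1) (al_pos h2) (ga_pos h2) (abc h2)

lemma term_eq {τ τ₁ τ₂ : ℂ} (h : 0 < τ.im) (h1 : 0 < τ₁.im) (h2 : 0 < τ₂.im) (v : Idx) :
    (τ.im : ℂ) * e ((τ * ((Complex.normSq ((v.1.1 : ℂ) * τ₁ * τ₂ + (v.1.2 : ℂ) * τ₁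
            + (v.2.1 : ℂ) * τ₂ + (v.2.2 : ℂ)) : ℝ) : ℂ)
        - (starRingEnd ℂ) τ *
            ((Complex.normSq ((v.1.1 : ℂ) * τ₁ * (starRingEnd ℂ) τ₂ + (v.1.2 : ℂ) * τ₁
              + (v.2.1 : ℂ) * (starRingEnd ℂ) τ₂ + (v.2.2 : ℂ)) : ℝ) : ℂ))
      / (4 * (τ₁.im : ℂ) * (τ₂.im : ℂ))) = Complex.exp (Lc v (Phi τ τ₁ τ₂)) := by
  have hl : (τ.im : ℂ) = Complex.exp (Real.log τ.im : ℝ) := by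
    rw [← Complex.ofReal_exp, Real.exp_log h]
  rw [Phi, Lc_Psi, e]
  nth_rewrite 1 [hl]
  rw [← Complex.exp_add]
  congr 1
  obtain ⟨⟨a, b⟩, ⟨c, d⟩⟩ := v
  obtain ⟨x, y⟩ := τ
  obtain ⟨x1, y1⟩ := τ₁
  obtain ⟨x2, y2⟩ := τ₂
  simp only at h h1 h2 ⊢
  have n1 : (y1 : ℂ) ≠ 0 := by exact_mod_cast h1.ne'
  have n2 : (y2 : ℂ) ≠ 0 := by exact_mod_cast h2.ne'
  rw [Complex.normSq_apply, Complex.normSq_apply, Complex.mk_eq_add_mul_I x y]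
  simp only [al, be, ga]
  simp only [map_add, map_mul, Complex.conj_ofReal, Complex.conj_I, Complex.add_re, Complex.add_im, Complex.mul_re, Complex.mul_im, Complex.conj_re, Complex.conj_im, Complex.intCast_re, Complex.intCast_im]
  push_cast
  field_simp
  ring_nf
  simp only [Complex.I_sq]
  ring

lemma Theta_eq {τ τ₁ τ₂ : ℂ} (h : 0 < τ.im) (h1 : 0 < τ₁.im) (h2 : 0 < τ₂.im) :
    Theta τ τ₁ τ₂ = G Lc (fun _ => (1:ℂ)) (Phi τ τ₁ τ₂) := by
  rw [Theta, G, ← tsum_mul_left]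
  refine tsum_congr fun v => ?_
  rw [term_eq h h1 h2, smul_eq_mul, mul_one]

lemma contDiffAt_Phi (p : ℂ × ℂ × ℂ) (h : 0 < p.1.im) (h1 : 0 < p.2.1.im) (h2 : 0 < p.2.2.im)
    (n : ℕ) : ContDiffAt ℝ n (fun p : ℂ × ℂ × ℂ => Phi p.1 p.2.1 p.2.2) p := by
  have re : ContDiff ℝ n Complex.re := Complex.reCLM.contDiff
  have im : ContDiff ℝ n Complex.im := Complex.imCLM.contDiff
  have r0 : ContDiffAt ℝ n (fun p : ℂ × ℂ × ℂ => p.1.re) p := by fun_prop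
  have r1 : ContDiffAt ℝ n (fun p : ℂ × ℂ × ℂ => p.2.1.re) p := by fun_prop
  have r2 : ContDiffAt ℝ n (fun p : ℂ × ℂ × ℂ => p.2.2.re) p := by fun_prop
  have i0 : ContDiffAt ℝ n (fun p : ℂ × ℂ × ℂ => p.1.im) p := by fun_prop
  have i1 : ContDiffAt ℝ n (fun p : ℂ × ℂ × ℂ => p.2.1.im) p := by fun_prop
  have i2 : ContDiffAt ℝ n (fun p : ℂ × ℂ × ℂ => p.2.2.im) p := by fun_prop
  have l0 := i0.log h.ne'
  have a1 := ((r1.pow 2).div i1 h1.ne').add i1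
  have a2 := ((r2.pow 2).div i2 h2.ne').add i2
  have b1 := r1.div i1 h1.ne'
  have b2 := r2.div i2 h2.ne'
  have c1 := (contDiffAt_const (c := (1:ℝ))).div i1 h1.ne'
  have c2 := (contDiffAt_const (c := (1:ℝ))).div i2 h2.ne'
  rw [contDiffAt_pi]
  intro k
  fin_cases k
  · exact l0
  · exact r0
  · exact i0.mul (a1.mul a2)
  · exact i0.mul (b1.mul a2)
  · exact i0.mul (c1.mul a2)
  · exact i0.mul (a1.mul c2)
  · exact i0.mul (b1.mul c2)
  · exact i0.mul (c1.mul c2)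
  · exact i0.mul (a1.mul b2)
  · exact i0.mul (b1.mul b2)
  · exact i0.mul (c1.mul b2)

lemma isOpen_UHP : IsOpen {z : ℂ | 0 < z.im} := isOpen_lt continuous_const Complex.continuous_im

lemma contDiffAt_Theta (p : ℂ × ℂ × ℂ) (h : 0 < p.1.im) (h1 : 0 < p.2.1.im) (h2 : 0 < p.2.2.im)
    (n : ℕ) : ContDiffAt ℝ n (fun p : ℂ × ℂ × ℂ => Theta p.1 p.2.1 p.2.2) p := by
  have hG : ContDiffAt ℝ n (G Lc (fun _ => (1:ℂ))) (Phi p.1 p.2.1 p.2.2) :=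
    (contDiffOn_G (q := fun v => 77 * N v) norm_Lc (fun c hc => summable_N c hc) n
      (c := fun _ => (1:ℂ)) (K := 1) (k := 0) (by simp)).contDiffAt
      ((isOpen_good norm_Lc).mem_nhds (good_Phi h h1 h2))
  have := hG.comp p (contDiffAt_Phi p h h1 h2 n)
  refine this.congr_of_eventuallyEq ?_
  have e0 : ∀ᶠ q : ℂ × ℂ × ℂ in nhds p, 0 < q.1.im :=
    continuousAt_fst.eventually (isOpen_UHP.mem_nhds h)
  have e1 : ∀ᶠ q : ℂ × ℂ × ℂ in nhds p, 0 < q.2.1.im :=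
    (continuous_fst.comp continuous_snd).continuousAt.eventually (isOpen_UHP.mem_nhds h1)
  have e2 : ∀ᶠ q : ℂ × ℂ × ℂ in nhds p, 0 < q.2.2.im :=
    (continuous_snd.comp continuous_snd).continuousAt.eventually (isOpen_UHP.mem_nhds h2)
  filter_upwards [e0, e1, e2] with q q0 q1 q2
  exact Theta_eq q0 q1 q2

lemma second_dir_G {f : ℂ → ℂ} {z : ℂ} (hf : ContDiffAt ℝ 2 f z) (d : ℂ)
    (γ γ₁ : ℝ → Fin 11 → ℝ) (γ₂ : Fin 11 → ℝ)
    (hfg : ∀ᶠ t : ℝ in nhds 0, f (z + t * d) = G Lc (fun _ => (1:ℂ)) (γ t))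
    (h1 : ∀ᶠ t in nhds 0, HasDerivAt γ (γ₁ t) t)
    (h2 : HasDerivAt γ₁ γ₂ 0) (hg : γ 0 ∈ Good Lc (fun v => 77 * N v)) :
    HasSum (fun v => Complex.exp (Lc v (γ 0)) * (Lc v (γ₁ 0) * Lc v (γ₁ 0) + Lc v γ₂))
      (fderiv ℝ (fun w => fderiv ℝ f w d) z d) := by
  obtain ⟨S, hS, hd⟩ := hasDerivAt2_G norm_Lc (fun c hc => summable_N c hc) γ γ₁ γ₂ h1 h2 hg
  rw [second_dir hf, Filter.EventuallyEq.deriv_eq (Filter.EventuallyEq.deriv hfg), hd]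
  exact hS

lemma hasDerivAt_Psi0 {l u v : ℝ → ℝ} {l' u' v' t : ℝ} (hl : HasDerivAt l l' t)
    (hu : HasDerivAt u u' t) (hv : HasDerivAt v v' t) (a1 b1 c1 a2 b2 c2 : ℝ) :
    HasDerivAt (fun t => Psi (l t) (u t) (v t) a1 b1 c1 a2 b2 c2)
      (Psi l' u' v' a1 b1 c1 a2 b2 c2) t := by
  rw [hasDerivAt_pi]
  intro k
  fin_cases k
  · exact hl
  · exact hu
  all_goals exact hv.mul_const _

lemma hasDerivAt_Psi1 {a b c : ℝ → ℝ} {a' b' c' t : ℝ} (ha : HasDerivAt a a' t)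
    (hb : HasDerivAt b b' t) (hc : HasDerivAt c c' t) (l u v a2 b2 c2 : ℝ) :
    HasDerivAt (fun t => Psi l u v (a t) (b t) (c t) a2 b2 c2)
      (Psi 0 0 v a' b' c' a2 b2 c2) t := by
  rw [hasDerivAt_pi]
  intro k
  fin_cases k
  · exact hasDerivAt_const t l
  · exact hasDerivAt_const t u
  · exact (ha.mul_const _).const_mul _
  · exact (hb.mul_const _).const_mul _
  · exact (hc.mul_const _).const_mul _
  · exact (ha.mul_const _).const_mul _
  · exact (hb.mul_const _).const_mul _
  · exact (hc.mul_const _).const_mul _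
  · exact (ha.mul_const _).const_mul _
  · exact (hb.mul_const _).const_mul _
  · exact (hc.mul_const _).const_mul _

lemma hasDerivAt_Psi2 {a b c : ℝ → ℝ} {a' b' c' t : ℝ} (ha : HasDerivAt a a' t)
    (hb : HasDerivAt b b' t) (hc : HasDerivAt c c' t) (l u v a1 b1 c1 : ℝ) :
    HasDerivAt (fun t => Psi l u v a1 b1 c1 (a t) (b t) (c t))
      (Psi 0 0 v a1 b1 c1 a' b' c') t := by
  rw [hasDerivAt_pi]
  intro k
  fin_cases k
  · exact hasDerivAt_const t l
  · exact hasDerivAt_const t u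
  · exact (ha.const_mul _).const_mul _
  · exact (ha.const_mul _).const_mul _
  · exact (ha.const_mul _).const_mul _
  · exact (hc.const_mul _).const_mul _
  · exact (hc.const_mul _).const_mul _
  · exact (hc.const_mul _).const_mul _
  · exact (hb.const_mul _).const_mul _
  · exact (hb.const_mul _).const_mul _
  · exact (hb.const_mul _).const_mul _

section derivs
variable (x y t : ℝ)

lemma hadd : HasDerivAt (fun t : ℝ => y + t) 1 t := (hasDerivAt_id t).const_add y

lemma dx_al : HasDerivAt (fun t => al (x + t) y) (2 * (x + t) / y) t := by
  have := (((hadd x t).pow 2).div_const y).add_const y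
  refine this.congr_deriv ?_
  simp

lemma dx_be : HasDerivAt (fun t => be (x + t) y) (1 / y) t := (hadd x t).div_const y

lemma dxx_al : HasDerivAt (fun t => 2 * (x + t) / y) (2 / y) t := by
  have := ((hadd x t).const_mul 2).div_const y
  simpa using this

lemma dy_ga (h : y + t ≠ 0) : HasDerivAt (fun t => ga (y + t)) (-1 / (y + t) ^ 2) t := by
  have := (hadd y t).inv h
  refine this.congr_of_eventuallyEq (Filter.Eventually.of_forall fun s => ?_)
  simp [ga]

lemma dy_be (h : y + t ≠ 0) : HasDerivAt (fun t => be x (y + t)) (x * (-1 / (y + t) ^ 2)) t := by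
  have := (dy_ga y t h).const_mul x
  simpa [ga, be, div_eq_mul_inv] using this

lemma dy_al (h : y + t ≠ 0) :
    HasDerivAt (fun t => al x (y + t)) (x ^ 2 * (-1 / (y + t) ^ 2) + 1) t := by
  have := ((dy_ga y t h).const_mul (x ^ 2)).add (hadd y t)
  refine this.congr_of_eventuallyEq (Filter.Eventually.of_forall fun s => ?_)
  simp [ga, al, div_eq_mul_inv]

lemma dyy_ga (h : y ≠ 0) : HasDerivAt (fun t => -1 / (y + t) ^ 2) (2 / y ^ 3) 0 := by
  have h' : y + 0 ≠ 0 := by simpa using h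
  have := (hasDerivAt_const (0:ℝ) (-1:ℝ)).div ((hadd y 0).pow 2) (pow_ne_zero 2 h')
  refine this.congr_deriv ?_
  simp
  field_simp

lemma dyy_be (h : y ≠ 0) : HasDerivAt (fun t => x * (-1 / (y + t) ^ 2)) (x * (2 / y ^ 3)) 0 :=
  (dyy_ga y h).const_mul x

lemma dyy_al (h : y ≠ 0) :
    HasDerivAt (fun t => x ^ 2 * (-1 / (y + t) ^ 2) + 1) (x ^ 2 * (2 / y ^ 3)) 0 :=
  ((dyy_ga y h).const_mul (x ^ 2)).add_const 1

lemma dl (h : y + t ≠ 0) : HasDerivAt (fun t => Real.log (y + t)) (1 / (y + t)) t :=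
  (hadd y t).log h

lemma dll (h : y ≠ 0) : HasDerivAt (fun t => 1 / (y + t)) (-1 / y ^ 2) 0 := by
  have := dy_ga y 0 (by simpa using h)
  simpa [ga] using this

lemma ev_pos (h : 0 < y) : ∀ᶠ t : ℝ in nhds 0, 0 < y + t := by
  have : ContinuousAt (fun t : ℝ => y + t) 0 := by fun_prop
  exact this.eventually_const_lt (by simpa using h)

end derivs

lemma lap0 {τ τ₁ τ₂ : ℂ} (h : 0 < τ.im) (h1 : 0 < τ₁.im) (h2 : 0 < τ₂.im) :
    HasSum (fun v : Idx => Complex.exp (Lc v (Phi τ τ₁ τ₂)) * (-(τ.im : ℂ) ^ 2 *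
      ((Lc v (Psi 0 1 0 (al τ₁.re τ₁.im) (be τ₁.re τ₁.im) (ga τ₁.im)
          (al τ₂.re τ₂.im) (be τ₂.re τ₂.im) (ga τ₂.im)) ^ 2
        + Lc v (Psi 0 0 0 (al τ₁.re τ₁.im) (be τ₁.re τ₁.im) (ga τ₁.im)
          (al τ₂.re τ₂.im) (be τ₂.re τ₂.im) (ga τ₂.im)))
      + (Lc v (Psi (1 / τ.im) 0 1 (al τ₁.re τ₁.im) (be τ₁.re τ₁.im) (ga τ₁.im)
          (al τ₂.re τ₂.im) (be τ₂.re τ₂.im) (ga τ₂.im)) ^ 2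
        + Lc v (Psi (-1 / τ.im ^ 2) 0 0 (al τ₁.re τ₁.im) (be τ₁.re τ₁.im) (ga τ₁.im)
          (al τ₂.re τ₂.im) (be τ₂.re τ₂.im) (ga τ₂.im))))))
      (lap (fun t => Theta t τ₁ τ₂) τ) := by
  have hf : ContDiffAt ℝ 2 (fun t => Theta t τ₁ τ₂) τ :=
    (contDiffAt_Theta (τ, τ₁, τ₂) h h1 h2 2).comp τ
      (f := fun t => (t, τ₁, τ₂)) (contDiffAt_id.prodMk contDiffAt_const)
  have A := second_dir_G hf 1
    (fun t => Psi (Real.log τ.im) (τ.re + t) τ.im (al τ₁.re τ₁.im) (be τ₁.re τ₁.im) (ga τ₁.im)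
      (al τ₂.re τ₂.im) (be τ₂.re τ₂.im) (ga τ₂.im))
    (fun t => Psi 0 1 0 (al τ₁.re τ₁.im) (be τ₁.re τ₁.im) (ga τ₁.im)
      (al τ₂.re τ₂.im) (be τ₂.re τ₂.im) (ga τ₂.im))
    (Psi 0 0 0 (al τ₁.re τ₁.im) (be τ₁.re τ₁.im) (ga τ₁.im)
      (al τ₂.re τ₂.im) (be τ₂.re τ₂.im) (ga τ₂.im))
    (Filter.Eventually.of_forall fun t => by
      rw [Theta_eq (by simpa using h) h1 h2]; simp [Phi])
    (Filter.Eventually.of_forall fun t =>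
      hasDerivAt_Psi0 (hasDerivAt_const _ _) (hadd _ _) (hasDerivAt_const _ _) _ _ _ _ _ _)
    (hasDerivAt_Psi0 (hasDerivAt_const _ _) (hasDerivAt_const _ _) (hasDerivAt_const _ _)
      _ _ _ _ _ _)
    (good_Psi h (al_pos h1) (ga_pos h1) (abc h1) (al_pos h2) (ga_pos h2) (abc h2))
  have B := second_dir_G hf I
    (fun t => Psi (Real.log (τ.im + t)) τ.re (τ.im + t) (al τ₁.re τ₁.im) (be τ₁.re τ₁.im)
      (ga τ₁.im) (al τ₂.re τ₂.im) (be τ₂.re τ₂.im) (ga τ₂.im))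
    (fun t => Psi (1 / (τ.im + t)) 0 1 (al τ₁.re τ₁.im) (be τ₁.re τ₁.im) (ga τ₁.im)
      (al τ₂.re τ₂.im) (be τ₂.re τ₂.im) (ga τ₂.im))
    (Psi (-1 / τ.im ^ 2) 0 0 (al τ₁.re τ₁.im) (be τ₁.re τ₁.im) (ga τ₁.im)
      (al τ₂.re τ₂.im) (be τ₂.re τ₂.im) (ga τ₂.im))
    ((ev_pos _ h).mono fun t ht => by
      rw [Theta_eq (by simpa using ht) h1 h2]; simp [Phi])
    ((ev_pos _ h).mono fun t ht =>
      hasDerivAt_Psi0 (dl _ _ ht.ne') (hasDerivAt_const _ _) (hadd _ _) _ _ _ _ _ _)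
    (hasDerivAt_Psi0 (dll _ h.ne') (hasDerivAt_const _ _) (hasDerivAt_const _ _)
      _ _ _ _ _ _)
    (good_Psi (by simpa using h) (al_pos h1) (ga_pos h1) (abc h1) (al_pos h2) (ga_pos h2) (abc h2))
  have C := (A.add B).mul_left (-(τ.im : ℂ) ^ 2)
  unfold lap
  refine hasSum_of_eq C fun v => ?_
  simp only [Phi, add_zero]
  ring

lemma lap1 {τ τ₁ τ₂ : ℂ} (h : 0 < τ.im) (h1 : 0 < τ₁.im) (h2 : 0 < τ₂.im) :
    HasSum (fun v : Idx => Complex.exp (Lc v (Phi τ τ₁ τ₂)) * (-(τ₁.im : ℂ) ^ 2 *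
      ((Lc v (Psi 0 0 τ.im (2 * τ₁.re / τ₁.im) (1 / τ₁.im) 0
          (al τ₂.re τ₂.im) (be τ₂.re τ₂.im) (ga τ₂.im)) ^ 2
        + Lc v (Psi 0 0 τ.im (2 / τ₁.im) 0 0
          (al τ₂.re τ₂.im) (be τ₂.re τ₂.im) (ga τ₂.im)))
      + (Lc v (Psi 0 0 τ.im (τ₁.re ^ 2 * (-1 / τ₁.im ^ 2) + 1) (τ₁.re * (-1 / τ₁.im ^ 2))
          (-1 / τ₁.im ^ 2) (al τ₂.re τ₂.im) (be τ₂.re τ₂.im) (ga τ₂.im)) ^ 2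
        + Lc v (Psi 0 0 τ.im (τ₁.re ^ 2 * (2 / τ₁.im ^ 3)) (τ₁.re * (2 / τ₁.im ^ 3))
          (2 / τ₁.im ^ 3) (al τ₂.re τ₂.im) (be τ₂.re τ₂.im) (ga τ₂.im))))))
      (lap (fun t => Theta τ t τ₂) τ₁) := by
  have hf : ContDiffAt ℝ 2 (fun t => Theta τ t τ₂) τ₁ :=
    (contDiffAt_Theta (τ, τ₁, τ₂) h h1 h2 2).comp τ₁
      (f := fun t => (τ, t, τ₂)) (contDiffAt_const.prodMk (contDiffAt_id.prodMk contDiffAt_const))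
  have A := second_dir_G hf 1
    (fun t => Psi (Real.log τ.im) τ.re τ.im (al (τ₁.re + t) τ₁.im) (be (τ₁.re + t) τ₁.im) (ga τ₁.im)
      (al τ₂.re τ₂.im) (be τ₂.re τ₂.im) (ga τ₂.im))
    (fun t => Psi 0 0 τ.im (2 * (τ₁.re + t) / τ₁.im) (1 / τ₁.im) 0
      (al τ₂.re τ₂.im) (be τ₂.re τ₂.im) (ga τ₂.im))
    (Psi 0 0 τ.im (2 / τ₁.im) 0 0 (al τ₂.re τ₂.im) (be τ₂.re τ₂.im) (ga τ₂.im))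
    (Filter.Eventually.of_forall fun t => by
      rw [Theta_eq h (by simpa using h1) h2]; simp [Phi])
    (Filter.Eventually.of_forall fun t =>
      hasDerivAt_Psi1 (dx_al _ _ _) (dx_be _ _ _) (hasDerivAt_const _ _) _ _ _ _ _ _)
    (hasDerivAt_Psi1 (dxx_al _ _ _) (hasDerivAt_const _ _) (hasDerivAt_const _ _)
      _ _ _ _ _ _)
    (good_Psi h (al_pos h1) (ga_pos h1) (abc h1) (al_pos h2) (ga_pos h2) (abc h2))
  have B := second_dir_G hf I
    (fun t => Psi (Real.log τ.im) τ.re τ.im (al τ₁.re (τ₁.im + t)) (be τ₁.re (τ₁.im + t))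
      (ga (τ₁.im + t)) (al τ₂.re τ₂.im) (be τ₂.re τ₂.im) (ga τ₂.im))
    (fun t => Psi 0 0 τ.im (τ₁.re ^ 2 * (-1 / (τ₁.im + t) ^ 2) + 1)
      (τ₁.re * (-1 / (τ₁.im + t) ^ 2)) (-1 / (τ₁.im + t) ^ 2)
      (al τ₂.re τ₂.im) (be τ₂.re τ₂.im) (ga τ₂.im))
    (Psi 0 0 τ.im (τ₁.re ^ 2 * (2 / τ₁.im ^ 3)) (τ₁.re * (2 / τ₁.im ^ 3))
          (2 / τ₁.im ^ 3) (al τ₂.re τ₂.im) (be τ₂.re τ₂.im) (ga τ₂.im))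
    ((ev_pos _ h1).mono fun t ht => by
      rw [Theta_eq h (by simpa using ht) h2]; simp [Phi])
    ((ev_pos _ h1).mono fun t ht =>
      hasDerivAt_Psi1 (dy_al _ _ _ ht.ne') (dy_be _ _ _ ht.ne') (dy_ga _ _ ht.ne') _ _ _ _ _ _)
    (hasDerivAt_Psi1 (dyy_al _ _ h1.ne') (dyy_be _ _ h1.ne') (dyy_ga _ h1.ne')
      _ _ _ _ _ _)
    (by
      simp only [add_zero]
      exact good_Psi h (al_pos h1) (ga_pos h1) (abc h1) (al_pos h2) (ga_pos h2) (abc h2))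
  have C := (A.add B).mul_left (-(τ₁.im : ℂ) ^ 2)
  unfold lap
  refine hasSum_of_eq C fun v => ?_
  simp only [Phi, add_zero]
  ring

lemma lap2 {τ τ₁ τ₂ : ℂ} (h : 0 < τ.im) (h1 : 0 < τ₁.im) (h2 : 0 < τ₂.im) :
    HasSum (fun v : Idx => Complex.exp (Lc v (Phi τ τ₁ τ₂)) * (-(τ₂.im : ℂ) ^ 2 *
      ((Lc v (Psi 0 0 τ.im (al τ₁.re τ₁.im) (be τ₁.re τ₁.im) (ga τ₁.im)
          (2 * τ₂.re / τ₂.im) (1 / τ₂.im) 0) ^ 2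
        + Lc v (Psi 0 0 τ.im (al τ₁.re τ₁.im) (be τ₁.re τ₁.im) (ga τ₁.im) (2 / τ₂.im) 0 0))
      + (Lc v (Psi 0 0 τ.im (al τ₁.re τ₁.im) (be τ₁.re τ₁.im) (ga τ₁.im)
          (τ₂.re ^ 2 * (-1 / τ₂.im ^ 2) + 1) (τ₂.re * (-1 / τ₂.im ^ 2)) (-1 / τ₂.im ^ 2)) ^ 2
        + Lc v (Psi 0 0 τ.im (al τ₁.re τ₁.im) (be τ₁.re τ₁.im) (ga τ₁.im)
          (τ₂.re ^ 2 * (2 / τ₂.im ^ 3)) (τ₂.re * (2 / τ₂.im ^ 3)) (2 / τ₂.im ^ 3))))))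
      (lap (fun t => Theta τ τ₁ t) τ₂) := by
  have hf : ContDiffAt ℝ 2 (fun t => Theta τ τ₁ t) τ₂ :=
    (contDiffAt_Theta (τ, τ₁, τ₂) h h1 h2 2).comp τ₂
      (f := fun t => (τ, τ₁, t)) (contDiffAt_const.prodMk (contDiffAt_const.prodMk contDiffAt_id))
  have A := second_dir_G hf 1
    (fun t => Psi (Real.log τ.im) τ.re τ.im (al τ₁.re τ₁.im) (be τ₁.re τ₁.im) (ga τ₁.im)
      (al (τ₂.re + t) τ₂.im) (be (τ₂.re + t) τ₂.im) (ga τ₂.im))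
    (fun t => Psi 0 0 τ.im (al τ₁.re τ₁.im) (be τ₁.re τ₁.im) (ga τ₁.im)
      (2 * (τ₂.re + t) / τ₂.im) (1 / τ₂.im) 0)
    (Psi 0 0 τ.im (al τ₁.re τ₁.im) (be τ₁.re τ₁.im) (ga τ₁.im) (2 / τ₂.im) 0 0)
    (Filter.Eventually.of_forall fun t => by
      rw [Theta_eq h h1 (by simpa using h2)]; simp [Phi])
    (Filter.Eventually.of_forall fun t =>
      hasDerivAt_Psi2 (dx_al _ _ _) (dx_be _ _ _) (hasDerivAt_const _ _) _ _ _ _ _ _)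
    (hasDerivAt_Psi2 (dxx_al _ _ _) (hasDerivAt_const _ _) (hasDerivAt_const _ _)
      _ _ _ _ _ _)
    (good_Psi h (al_pos h1) (ga_pos h1) (abc h1) (al_pos h2) (ga_pos h2) (abc h2))
  have B := second_dir_G hf I
    (fun t => Psi (Real.log τ.im) τ.re τ.im (al τ₁.re τ₁.im) (be τ₁.re τ₁.im) (ga τ₁.im)
      (al τ₂.re (τ₂.im + t)) (be τ₂.re (τ₂.im + t)) (ga (τ₂.im + t)))
    (fun t => Psi 0 0 τ.im (al τ₁.re τ₁.im) (be τ₁.re τ₁.im) (ga τ₁.im)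
      (τ₂.re ^ 2 * (-1 / (τ₂.im + t) ^ 2) + 1)
      (τ₂.re * (-1 / (τ₂.im + t) ^ 2)) (-1 / (τ₂.im + t) ^ 2))
    (Psi 0 0 τ.im (al τ₁.re τ₁.im) (be τ₁.re τ₁.im) (ga τ₁.im)
      (τ₂.re ^ 2 * (2 / τ₂.im ^ 3)) (τ₂.re * (2 / τ₂.im ^ 3)) (2 / τ₂.im ^ 3))
    ((ev_pos _ h2).mono fun t ht => by
      rw [Theta_eq h h1 (by simpa using ht)]; simp [Phi])
    ((ev_pos _ h2).mono fun t ht =>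
      hasDerivAt_Psi2 (dy_al _ _ _ ht.ne') (dy_be _ _ _ ht.ne') (dy_ga _ _ ht.ne') _ _ _ _ _ _)
    (hasDerivAt_Psi2 (dyy_al _ _ h2.ne') (dyy_be _ _ h2.ne') (dyy_ga _ h2.ne')
      _ _ _ _ _ _)
    (by
      simp only [add_zero]
      exact good_Psi h (al_pos h1) (ga_pos h1) (abc h1) (al_pos h2) (ga_pos h2) (abc h2))
  have C := (A.add B).mul_left (-(τ₂.im : ℂ) ^ 2)
  unfold lap
  refine hasSum_of_eq C fun v => ?_
  simp only [Phi, add_zero]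
  ring

lemma lap01 {τ τ₁ τ₂ : ℂ} (h : 0 < τ.im) (h1 : 0 < τ₁.im) (h2 : 0 < τ₂.im) :
    lap (fun t => Theta t τ₁ τ₂) τ = lap (fun t => Theta τ t τ₂) τ₁ := by
  refine (lap0 h h1 h2).unique ?_
  convert lap1 h h1 h2 using 1
  funext v
  congr 1
  simp only [Lc_Psi]
  have n : (τ.im : ℂ) ≠ 0 := by exact_mod_cast h.ne'
  have n1 : (τ₁.im : ℂ) ≠ 0 := by exact_mod_cast h1.ne'
  have n2 : (τ₂.im : ℂ) ≠ 0 := by exact_mod_cast h2.ne'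
  simp only [al, be, ga]
  push_cast
  field_simp
  ring_nf
  simp only [Complex.I_sq]
  ring

lemma lap12 {τ τ₁ τ₂ : ℂ} (h : 0 < τ.im) (h1 : 0 < τ₁.im) (h2 : 0 < τ₂.im) :
    lap (fun t => Theta τ t τ₂) τ₁ = lap (fun t => Theta τ τ₁ t) τ₂ := by
  refine (lap1 h h1 h2).unique ?_
  convert lap2 h h1 h2 using 1
  funext v
  congr 1
  simp only [Lc_Psi]
  have n1 : (τ₁.im : ℂ) ≠ 0 := by exact_mod_cast h1.ne'
  have n2 : (τ₂.im : ℂ) ≠ 0 := by exact_mod_cast h2.ne'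
  simp only [al, be, ga]
  push_cast
  field_simp
  ring

/-- the series defining `Θ(τ;τ₁,τ₂)` converges absolutely (and the resulting
function is smooth) on `ℍ × ℍ × ℍ`, and the hyperbolic Laplacians in the three variables
agree: `Δ^τ Θ = Δ^{τ₁} Θ = Δ^{τ₂} Θ`. -/
theorem stmt9 :
    (∀ τ ∈ UHP, ∀ τ₁ ∈ UHP, ∀ τ₂ ∈ UHP,
      Summable (fun v : (ℤ × ℤ) × (ℤ × ℤ) =>
        ‖e ((τ * ((Complex.normSq ((v.1.1 : ℂ) * τ₁ * τ₂ + (v.1.2 : ℂ) * τ₁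
                + (v.2.1 : ℂ) * τ₂ + (v.2.2 : ℂ)) : ℝ) : ℂ)
            - (starRingEnd ℂ) τ *
                ((Complex.normSq ((v.1.1 : ℂ) * τ₁ * (starRingEnd ℂ) τ₂ + (v.1.2 : ℂ) * τ₁
                  + (v.2.1 : ℂ) * (starRingEnd ℂ) τ₂ + (v.2.2 : ℂ)) : ℝ) : ℂ))
          / (4 * (τ₁.im : ℂ) * (τ₂.im : ℂ)))‖))
    ∧ ContDiffOn ℝ (⊤ : ℕ∞) (fun p : ℂ × ℂ × ℂ => Theta p.1 p.2.1 p.2.2)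
        {p : ℂ × ℂ × ℂ | 0 < p.1.im ∧ 0 < p.2.1.im ∧ 0 < p.2.2.im}
    ∧ (∀ τ ∈ UHP, ∀ τ₁ ∈ UHP, ∀ τ₂ ∈ UHP,
        lap (fun t => Theta t τ₁ τ₂) τ = lap (fun t => Theta τ t τ₂) τ₁
        ∧ lap (fun t => Theta τ t τ₂) τ₁ = lap (fun t => Theta τ τ₁ t) τ₂) := by
  refine ⟨fun τ h τ₁ h1 τ₂ h2 => ?_, ?_, fun τ h τ₁ h1 τ₂ h2 => ⟨lap01 h h1 h2, lap12 h h1 h2⟩⟩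
  · have h' : 0 < τ.im := h
    have n : (τ.im : ℂ) ≠ 0 := by exact_mod_cast h'.ne'
    have hs := summable_G (q := fun v => 77 * N v) norm_Lc (fun c hc => summable_N c hc)
      (c := fun _ => (1:ℂ)) (K := 1) (k := 0) (by simp) (good_Phi h h1 h2)
    refine (hs.mul_left ‖(τ.im : ℂ)⁻¹‖).congr fun v => ?_
    rw [smul_eq_mul, mul_one, ← norm_mul, ← term_eq h h1 h2, inv_mul_cancel_left₀ n]
  · rintro p ⟨h, h1, h2⟩
    exact (contDiffAt_infty.2 fun n => contDiffAt_Theta p h h1 h2 n).contDiffWithinAt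
end
end

section
/- In the lattice setting, assume additionally that (·,·) is negative definite on V₂. Extend (·,·) to V ⊗ ℝ, and let v⁺ ⊆ V₁ ⊗ ℝ be a subspace on which the form is positive definite and whose orthogonal complement v⁻ in V ⊗ ℝ is negative definite; for x ∈ V ⊗ ℝ write x = x_{v⁺} + x_{v⁻} for the orthogonal decomposition. For a coset µ + Λ of a lattice Λ define Θ_{µ+Λ}(τ, v⁺) := Σ_{x ∈ µ+Λ} e( τ·(x_{v⁺},x_{v⁺})/2 + τ̄·(x_{v⁻},x_{v⁻})/2 ), and for λ ∈ L', ν ∈ N' define ϑ_{λ,ν}(τ) := Σ_{m ∈ M', m+ν ∈ λ+L} e(−τ·(m,m)/2). Then all these series converge absolutely for τ ∈ ℍ, and for every λ ∈ L' and every set S of representatives of N'/N one has Θ_{λ+L}(τ, v⁺) = Σ_{ν ∈ S} Θ_{ν+N}(τ, v⁺) · conj( ϑ_{λ,ν}(τ) ). -/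
noncomputable section

open Complex Real

lemma sum1d (c : ℝ) (hc : 0 < c) (a : ℝ) :
    Summable (fun k : ℤ => Real.exp (-c * (a + k) ^ 2)) := by
  have h0 : Summable (fun n : ℕ => Real.exp (n * (-(2 * c)))) :=
    Real.summable_exp_nat_mul_iff.mpr (by linarith)
  have h1 : Summable (fun k : ℤ => Real.exp (-(2 * c) * |(k : ℝ)|)) := by
    apply Summable.of_nat_of_neg
    · refine h0.congr fun n => ?_
      congr 1
      simp [mul_comm]
    · refine h0.congr fun n => ?_
      congr 1
      simp [mul_comm]
  refine Summable.of_nonneg_of_le (fun _ => (Real.exp_pos _).le) (fun k => ?_)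
    (h1.mul_left (Real.exp (c * (2 * |a| + 1))))
  rw [← Real.exp_add]
  apply Real.exp_le_exp.mpr
  have h2 : (a + k) ^ 2 ≥ 2 * |a + k| - 1 := by
    nlinarith [sq_nonneg (|a + (k : ℝ)| - 1), sq_abs (a + (k : ℝ))]
  have h3 : |(k : ℝ)| ≤ |a + k| + |a| := by
    have := abs_sub (a + (k : ℝ)) a
    simpa using this
  have h4 : (a + k) ^ 2 ≥ 2 * |(k : ℝ)| - 2 * |a| - 1 := by linarith
  nlinarith

lemma sumnd (n : ℕ) (f : Fin n → ℤ → ℝ) (hf : ∀ i, Summable (f i)) (h0 : ∀ i k, 0 ≤ f i k) :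
    Summable (fun k : Fin n → ℤ => ∏ i, f i (k i)) := by
  induction n with
  | zero => exact Summable.of_finite
  | succ n ih =>
    have h := ih (fun i => f i.succ) (fun i => hf _) (fun i => h0 _)
    have h2 := (hf 0).mul_of_nonneg h (fun k => h0 0 k)
      (fun k => Finset.prod_nonneg fun i _ => h0 _ _)
    rw [← (Fin.consEquiv (fun _ : Fin (n + 1) => ℤ)).summable_iff]
    refine h2.congr fun k => ?_
    simp [Fin.prod_univ_succ, Fin.consEquiv]

lemma core {V : Type*} [AddCommGroup V] [Module ℝ V]
    (B : V →ₗ[ℝ] V →ₗ[ℝ] ℝ)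
    (hsymm : ∀ x y : V, B x y = B y x)
    (hnd : ∀ v : V, (∀ w : V, B v w = 0) → v = 0)
    (L : Submodule ℤ V) (hLfg : L.FG)
    (hLspan : Submodule.span ℝ (L : Set V) = ⊤)
    (heven : ∀ l ∈ L, ∃ z : ℤ, B l l = 2 * (z : ℝ))
    (p q : V →ₗ[ℝ] V) (hpq : ∀ x, p x + q x = x)
    (hort : ∀ x y, B (p x) (q y) = 0)
    (hp : ∀ x, 0 ≤ B (p x) (p x)) (hq : ∀ x, B (q x) (q x) ≤ 0)
    (c : ℝ) (hc : 0 < c) (μ : V) :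
    Summable (fun x : {y : V | y - μ ∈ (L : Set V)} =>
      Real.exp (-c * (B (p x) (p x) - B (q x) (q x)))) := by
  obtain ⟨n, b, hb⟩ := Submodule.fg_iff_exists_fin_generating_family.mp hLfg
  have hbL : ∀ i, b i ∈ L := fun i => hb ▸ Submodule.subset_span ⟨i, rfl⟩
  have hcs : ∀ x y, B x y ^ 2 ≤ (B (p x) (p x) - B (q x) (q x)) * (B (p y) (p y) - B (q y) (q y)) := by
    intro x y
    have hxy : B x y = B (p x) (p y) + B (q x) (q y) := by
      conv_lhs => rw [← hpq x, ← hpq y]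
      simp [hort, hsymm (q x) (p y)]
    have := discrim_le_zero (a := B (p x) (p x) - B (q x) (q x)) (b := 2 * B x y)
      (c := B (p y) (p y) - B (q y) (q y)) (by
        intro t
        have h1 := hp (t • x + y)
        have h2 := hq (t • x - y)
        simp only [map_add, map_sub, map_smul, LinearMap.add_apply, LinearMap.sub_apply,
          LinearMap.smul_apply, smul_eq_mul, hsymm (p y) (p x), hsymm (q y) (q x)] at h1 h2
        rw [hxy]
        linarith)
    unfold discrim at this
    linarith
  have hint : ∀ x : {y : V | y - μ ∈ (L : Set V)}, ∀ i, ∃ z : ℤ, B (x - μ) (b i) = z := by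
    intro x i
    have hx : (x : V) - μ ∈ L := x.2
    obtain ⟨z1, h1⟩ := heven _ hx
    obtain ⟨z2, h2⟩ := heven _ (hbL i)
    obtain ⟨z3, h3⟩ := heven _ (L.add_mem hx (hbL i))
    refine ⟨z3 - z1 - z2, ?_⟩
    rw [map_add B, LinearMap.add_apply, map_add, map_add, hsymm (b i) (x - μ), h1, h2] at h3
    push_cast
    linarith
  choose k hk using hint
  have hkinj : Function.Injective k := by
    intro x y hxy
    have h0 : ∀ i, B ((x : V) - y) (b i) = 0 := by
      intro i
      have h1 := hk x i
      have h2 := hk y i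
      rw [hxy] at h1
      have : (x : V) - y = (x - μ) - (y - μ) := by abel
      rw [this, map_sub, LinearMap.sub_apply, h1, h2, sub_self]
    have hz : (x : V) - y = 0 := by
      apply hnd
      have hL : ∀ l ∈ L, B ((x : V) - y) l = 0 := by
        intro l hl
        rw [← hb] at hl
        induction hl using Submodule.span_induction with
        | mem l h => obtain ⟨i, rfl⟩ := h; exact h0 i
        | zero => simp
        | add u v _ _ hu hv => rw [map_add, hu, hv, add_zero]
        | smul a u _ hu => rw [map_zsmul, hu, smul_zero]
      intro w
      have hw : w ∈ Submodule.span ℝ (L : Set V) := hLspan ▸ Submodule.mem_top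
      induction hw using Submodule.span_induction with
      | mem l h => exact hL l h
      | zero => simp
      | add u v _ _ hu hv => rw [map_add, hu, hv, add_zero]
      | smul a u _ hu => rw [map_smul, hu, smul_zero]
    exact Subtype.ext (sub_eq_zero.mp hz)
  set C : ℝ := ∑ i, (B (p (b i)) (p (b i)) - B (q (b i)) (q (b i))) + 1 with hC
  have hCpos : 0 < C := by
    have : 0 ≤ ∑ i, (B (p (b i)) (p (b i)) - B (q (b i)) (q (b i))) :=
      Finset.sum_nonneg fun i _ => by linarith [hp (b i), hq (b i)]
    linarith
  have hsum := sumnd n (fun i k => Real.exp (-(c / C) * (B μ (b i) + k) ^ 2))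
    (fun i => sum1d _ (div_pos hc hCpos) _) (fun i k => (Real.exp_pos _).le)
  refine Summable.of_nonneg_of_le (fun _ => (Real.exp_pos _).le) (fun x => ?_)
    (hsum.comp_injective hkinj)
  simp only [Function.comp]
  rw [← Real.exp_sum]
  apply Real.exp_le_exp.mpr
  have h1 : ∀ i, B μ (b i) + k x i = B x (b i) := by
    intro i
    rw [← hk x i, map_sub, LinearMap.sub_apply]; ring
  simp only [h1]
  rw [← Finset.mul_sum]
  have h2 : ∑ i, B x (b i) ^ 2 ≤ (B (p x) (p x) - B (q x) (q x)) * C := by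
    calc ∑ i, B x (b i) ^ 2 ≤ ∑ i, (B (p x) (p x) - B (q x) (q x)) *
          (B (p (b i)) (p (b i)) - B (q (b i)) (q (b i))) := Finset.sum_le_sum fun i _ => hcs _ _
      _ ≤ _ := by
        rw [← Finset.mul_sum]
        apply mul_le_mul_of_nonneg_left _ (by linarith [hp x, hq x])
        linarith
  have h3 := mul_le_mul_of_nonneg_left h2 (div_pos hc hCpos).le
  have h4 : c / C * ((B (p x) (p x) - B (q x) (q x)) * C)
      = c * (B (p x) (p x) - B (q x) (q x)) := by field_simp
  linarith

lemma norm_e (z : ℂ) : ‖e z‖ = Real.exp (-(2 * π * z.im)) := by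
  unfold e
  rw [Complex.norm_exp]
  congr 1
  simp

lemma norm_term (τ : ℂ) (a b : ℝ) :
    ‖e (τ * (a : ℂ) / 2 + (starRingEnd ℂ) τ * (b : ℂ) / 2)‖
      = Real.exp (-(π * τ.im) * (a - b)) := by
  rw [norm_e]
  congr 1
  have : (τ * (a : ℂ) / 2 + (starRingEnd ℂ) τ * (b : ℂ) / 2).im = τ.im * (a - b) / 2 := by
    have h1 : τ * (a : ℂ) / 2 = ((a / 2 : ℝ) : ℂ) * τ := by push_cast; ring
    have h2 : (starRingEnd ℂ) τ * (b : ℂ) / 2 = ((b / 2 : ℝ) : ℂ) * (starRingEnd ℂ) τ := by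
      push_cast; ring
    rw [h1, h2, Complex.add_im, Complex.im_ofReal_mul, Complex.im_ofReal_mul, Complex.conj_im]
    ring
  rw [this]
  ring

lemma conj_e (τ : ℂ) (b : ℝ) :
    (starRingEnd ℂ) (e (-τ * (b : ℂ) / 2)) = e ((starRingEnd ℂ) τ * (b : ℂ) / 2) := by
  unfold e
  rw [← Complex.exp_conj]
  congr 1
  simp only [map_mul, map_div₀, map_neg, Complex.conj_ofReal, Complex.conj_I, map_ofNat]
  ring

lemma e_add (z w : ℂ) : e (z + w) = e z * e w := by
  unfold e
  rw [← Complex.exp_add, mul_add]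

lemma hasSum_congr_aux {α : Type*} {f g : α → ℂ} {a : ℂ} (ha : HasSum f a)
    (h : ∀ x, g x = f x) : HasSum g a := by
  rwa [funext h]

lemma hasSum_mul_aux {α β : Type*} (f : α → ℂ) (g : β → ℂ) (a b : ℂ) (ha : HasSum f a)
    (hb : HasSum g b) (hf : Summable (fun x => ‖f x‖)) (hg : Summable (fun x => ‖g x‖)) :
    HasSum (fun x : α × β => f x.1 * g x.2) (a * b) :=
  ha.mul hb (summable_mul_of_summable_norm hf hg)

set_option maxHeartbeats 1000000 in
/-- in the lattice setting (with the form negative definite on `V₂`),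
extended to the reals, let `v⁺` be a positive definite subspace of `V₁` whose
orthogonal complement `v⁻` is negative definite, and write `x = x_{v⁺} + x_{v⁻}`.
Then the coset theta series `Θ_{µ+Λ}(τ,v⁺) = Σ_{x ∈ µ+Λ} e(τ(x⁺,x⁺)/2 + τ̄(x⁻,x⁻)/2)`
(for `Λ = L` and `Λ = N`) and the series
`ϑ_{λ,ν}(τ) = Σ_{m ∈ M', m+ν ∈ λ+L} e(−τ(m,m)/2)` all converge absolutely on `ℍ`,
and for every `λ ∈ L'` and every set `S` of representatives of `N'/N`,
`Θ_{λ+L}(τ,v⁺) = Σ_{ν ∈ S} Θ_{ν+N}(τ,v⁺) · conj(ϑ_{λ,ν}(τ))`. -/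
theorem stmt16
    (V : Type*) [AddCommGroup V] [Module ℝ V] [FiniteDimensional ℝ V]
    (B : V →ₗ[ℝ] V →ₗ[ℝ] ℝ)
    (hsymm : ∀ x y : V, B x y = B y x)
    (hnd : ∀ v : V, (∀ w : V, B v w = 0) → v = 0)
    (V₁ V₂ : Submodule ℝ V) (hcompl : IsCompl V₁ V₂)
    (horth : ∀ x ∈ V₁, ∀ y ∈ V₂, B x y = 0)
    (hneg : ∀ x ∈ V₂, x ≠ 0 → B x x < 0)
    (L : Submodule ℤ V) (hLfg : L.FG)
    (hLspan : Submodule.span ℝ (L : Set V) = ⊤)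
    (heven : ∀ l ∈ L, ∃ z : ℤ, B l l = 2 * (z : ℝ))
    (vp vm : Submodule ℝ V) (hvpV₁ : vp ≤ V₁) (hpm : IsCompl vp vm)
    (horthpm : ∀ x ∈ vp, ∀ y ∈ vm, B x y = 0)
    (hpos : ∀ x ∈ vp, x ≠ 0 → 0 < B x x)
    (hnegm : ∀ x ∈ vm, x ≠ 0 → B x x < 0)
    (lam : V) (hlam : ∀ l ∈ L, ∃ z : ℤ, B lam l = (z : ℝ))
    (Ndual : Set V)
    (hNdual : Ndual
      = {v : V | v ∈ V₁ ∧ ∀ x ∈ (L : Set V) ∩ (V₁ : Set V), ∃ z : ℤ, B v x = (z : ℝ)})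
    (S : Set V) (hSsub : S ⊆ Ndual)
    (hSrep : ∀ x ∈ Ndual, ∃! s : V, s ∈ S ∧ x - s ∈ (L : Set V) ∩ (V₁ : Set V)) :
    ∀ prp : V → V,
      prp = (fun x : V => ((Submodule.linearProjOfIsCompl vp vm hpm x : vp) : V)) →
    ∀ ThL ThN : V → ℂ → ℂ, ∀ vth : V → ℂ → ℂ,
      ThL = (fun μ τ => ∑' x : {y : V | y - μ ∈ (L : Set V)},
        e (τ * ((B (prp (x : V)) (prp (x : V)) : ℝ) : ℂ) / 2
          + (starRingEnd ℂ) τ *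
              ((B ((x : V) - prp (x : V)) ((x : V) - prp (x : V)) : ℝ) : ℂ) / 2)) →
      ThN = (fun μ τ => ∑' x : {y : V | y - μ ∈ ((L : Set V) ∩ (V₁ : Set V))},
        e (τ * ((B (prp (x : V)) (prp (x : V)) : ℝ) : ℂ) / 2
          + (starRingEnd ℂ) τ *
              ((B ((x : V) - prp (x : V)) ((x : V) - prp (x : V)) : ℝ) : ℂ) / 2)) →
      vth = (fun ν τ => ∑' m : {m : V |
          (m ∈ V₂ ∧ ∀ x ∈ (L : Set V) ∩ (V₂ : Set V), ∃ z : ℤ, B m x = (z : ℝ))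
            ∧ m + ν - lam ∈ L},
        e (-τ * ((B (m : V) (m : V) : ℝ) : ℂ) / 2)) →
      (∀ τ ∈ UHP, ∀ μ : V,
        Summable (fun x : {y : V | y - μ ∈ (L : Set V)} =>
          ‖e (τ * ((B (prp (x : V)) (prp (x : V)) : ℝ) : ℂ) / 2
            + (starRingEnd ℂ) τ *
                ((B ((x : V) - prp (x : V)) ((x : V) - prp (x : V)) : ℝ) : ℂ) / 2)‖))
      ∧ (∀ τ ∈ UHP, ∀ μ : V,
          Summable (fun x : {y : V | y - μ ∈ ((L : Set V) ∩ (V₁ : Set V))} =>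
            ‖e (τ * ((B (prp (x : V)) (prp (x : V)) : ℝ) : ℂ) / 2
              + (starRingEnd ℂ) τ *
                  ((B ((x : V) - prp (x : V)) ((x : V) - prp (x : V)) : ℝ) : ℂ) / 2)‖))
      ∧ (∀ τ ∈ UHP, ∀ ν ∈ Ndual,
          Summable (fun m : {m : V |
              (m ∈ V₂ ∧ ∀ x ∈ (L : Set V) ∩ (V₂ : Set V), ∃ z : ℤ, B m x = (z : ℝ))
                ∧ m + ν - lam ∈ L} =>
            ‖e (-τ * ((B (m : V) (m : V) : ℝ) : ℂ) / 2)‖))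
      ∧ (∀ τ ∈ UHP,
          HasSum (fun ν : S => ThN (ν : V) τ * (starRingEnd ℂ) (vth (ν : V) τ))
            (ThL lam τ)) := by
  intro prp hprp ThL ThN vth hThL hThN hvth
  set p : V →ₗ[ℝ] V := vp.subtype ∘ₗ (Submodule.linearProjOfIsCompl vp vm hpm) with hpdef
  have hprpp : ∀ x, prp x = p x := fun x => by rw [hprp]; rfl
  have hpmem : ∀ x, p x ∈ vp := fun x => (Submodule.linearProjOfIsCompl vp vm hpm x).2
  have hqmem : ∀ x, x - p x ∈ vm := by
    intro x
    rw [← Submodule.linearProjOfIsCompl_ker hpm, LinearMap.mem_ker, map_sub, sub_eq_zero]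
    exact (Submodule.linearProjOfIsCompl_apply_left hpm _).symm
  have hV2 : ∀ m ∈ V₂, p m = 0 := by
    intro m hm
    by_contra hne
    have h1 := hpos _ (hpmem m) hne
    have h2 := horth _ (hvpV₁ (hpmem m)) m hm
    have h3 := horthpm _ (hpmem m) _ (hqmem m)
    rw [map_sub] at h3
    linarith
  have nonneg_p : ∀ x, 0 ≤ B (p x) (p x) := by
    intro x
    by_cases h : p x = 0
    · simp [h]
    · exact (hpos _ (hpmem x) h).le
  have nonpos_q : ∀ x, B (x - p x) (x - p x) ≤ 0 := by
    intro x
    by_cases h : x - p x = 0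
    · simp [h]
    · exact (hnegm _ (hqmem x) h).le
  have S1 : ∀ τ ∈ UHP, ∀ μ : V,
        Summable (fun x : {y : V | y - μ ∈ (L : Set V)} =>
          ‖e (τ * ((B (prp (x : V)) (prp (x : V)) : ℝ) : ℂ) / 2
            + (starRingEnd ℂ) τ *
                ((B ((x : V) - prp (x : V)) ((x : V) - prp (x : V)) : ℝ) : ℂ) / 2)‖) := by
    intro τ hτ μ
    have hτ' : 0 < τ.im := hτ
    have := core B hsymm hnd L hLfg hLspan heven p (LinearMap.id - p) (fun x => by simp)
      (fun x y => horthpm _ (hpmem x) _ (hqmem y)) nonneg_p nonpos_q (π * τ.im)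
      (mul_pos Real.pi_pos hτ') μ
    refine this.congr fun x => ?_
    rw [norm_term, hprpp]
    rfl
  have S2 : ∀ τ ∈ UHP, ∀ μ : V,
          Summable (fun x : {y : V | y - μ ∈ ((L : Set V) ∩ (V₁ : Set V))} =>
            ‖e (τ * ((B (prp (x : V)) (prp (x : V)) : ℝ) : ℂ) / 2
              + (starRingEnd ℂ) τ *
                  ((B ((x : V) - prp (x : V)) ((x : V) - prp (x : V)) : ℝ) : ℂ) / 2)‖) := by
    intro τ hτ μ
    exact (S1 τ hτ μ).comp_injective
      (i := fun x : {y : V | y - μ ∈ ((L : Set V) ∩ (V₁ : Set V))} =>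
        (⟨x.1, x.2.1⟩ : {y : V | y - μ ∈ (L : Set V)}))
      (fun x y h => Subtype.ext (Subtype.mk.inj h))
  have S3 : ∀ τ ∈ UHP, ∀ ν : V,
          Summable (fun m : {m : V |
              (m ∈ V₂ ∧ ∀ x ∈ (L : Set V) ∩ (V₂ : Set V), ∃ z : ℤ, B m x = (z : ℝ))
                ∧ m + ν - lam ∈ L} =>
            ‖e (-τ * ((B (m : V) (m : V) : ℝ) : ℂ) / 2)‖) := by
    intro τ hτ ν
    have := (S1 τ hτ (lam - ν)).comp_injective
      (i := fun m : {m : V |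
              (m ∈ V₂ ∧ ∀ x ∈ (L : Set V) ∩ (V₂ : Set V), ∃ z : ℤ, B m x = (z : ℝ))
                ∧ m + ν - lam ∈ L} =>
        (⟨m.1, by
          have h := m.2.2
          rwa [show m.1 + ν - lam = m.1 - (lam - ν) by abel] at h⟩ :
            {y : V | y - (lam - ν) ∈ (L : Set V)}))
      (fun x y h => Subtype.ext (Subtype.mk.inj h))
    refine this.congr fun m => ?_
    simp only [Function.comp]
    rw [hprpp, hV2 _ m.2.1.1, ← Complex.norm_conj (e (-τ * _ / 2)), conj_e]
    simp
  refine ⟨S1, S2, fun τ hτ ν _ => S3 τ hτ ν, ?_⟩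
  intro τ hτ
  have hLint : ∀ l ∈ L, ∀ l' ∈ L, ∃ z : ℤ, B l l' = z := by
    intro l hl l' hl'
    obtain ⟨z1, h1⟩ := heven _ hl
    obtain ⟨z2, h2⟩ := heven _ hl'
    obtain ⟨z3, h3⟩ := heven _ (L.add_mem hl hl')
    refine ⟨z3 - z1 - z2, ?_⟩
    rw [map_add B, LinearMap.add_apply, map_add, map_add, hsymm l' l, h1, h2] at h3
    push_cast
    linarith
  have hxint : ∀ x : V, x - lam ∈ L → ∀ l ∈ L, ∃ z : ℤ, B x l = z := by
    intro x hx l hl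
    obtain ⟨z1, h1⟩ := hLint _ hx l hl
    obtain ⟨z2, h2⟩ := hlam l hl
    refine ⟨z1 + z2, ?_⟩
    rw [map_sub, LinearMap.sub_apply] at h1
    push_cast
    linarith
  have hN1 : ∀ x ∈ Ndual, x ∈ V₁ := by
    intro x hx
    rw [hNdual] at hx
    exact hx.1
  let T : S → Type _ := fun s => {y : V | y - (s : V) ∈ ((L : Set V) ∩ (V₁ : Set V))} ×
    {m : V | (m ∈ V₂ ∧ ∀ x ∈ (L : Set V) ∩ (V₂ : Set V), ∃ z : ℤ, B m x = (z : ℝ))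
                ∧ m + (s : V) - lam ∈ L}
  have hn1 : ∀ (s : S) (y : V), y - (s : V) ∈ ((L : Set V) ∩ (V₁ : Set V)) → y ∈ V₁ := by
    intro s y hy
    have h := V₁.add_mem hy.2 (hN1 _ (hSsub s.2))
    simpa using h
  let φ : (Σ s : S, T s) → {y : V | y - lam ∈ (L : Set V)} := fun t =>
    ⟨t.2.1.1 + t.2.2.1, by
      have h := L.add_mem t.2.1.2.1 t.2.2.2.2
      have h2 : t.2.1.1 + t.2.2.1 - lam
        = t.2.1.1 - (t.1 : V) + (t.2.2.1 + (t.1 : V) - lam) := by abel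
      show _ ∈ L
      rw [h2]; exact h⟩
  have hdisj : ∀ a ∈ V₁, ∀ b ∈ V₂, ∀ a' ∈ V₁, ∀ b' ∈ V₂, a + b = a' + b' → a = a' ∧ b = b' := by
    intro a ha b hb a' ha' b' hb' h
    have h1 : a - a' = b' - b := by
      rw [sub_eq_sub_iff_add_eq_add, h, add_comm]
    have h2 : a - a' = 0 := Submodule.disjoint_def.mp hcompl.disjoint _ (V₁.sub_mem ha ha')
      (h1 ▸ V₂.sub_mem hb' hb)
    refine ⟨sub_eq_zero.mp h2, ?_⟩
    rw [h2] at h1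
    exact (sub_eq_zero.mp h1.symm).symm
  have hSmem : ∀ (s : S) (y : V), y - (s : V) ∈ ((L : Set V) ∩ (V₁ : Set V)) → y ∈ Ndual := by
    intro s y hy
    have hs := hSsub s.2
    rw [hNdual] at hs ⊢
    refine ⟨hn1 s y hy, fun x hx => ?_⟩
    obtain ⟨z1, h1⟩ := hs.2 x hx
    obtain ⟨z2, h2⟩ := hLint _ hy.1 x hx.1
    refine ⟨z1 + z2, ?_⟩
    rw [map_sub, LinearMap.sub_apply] at h2
    push_cast
    linarith
  have hφ : Function.Bijective φ := by
    constructor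
    · rintro ⟨s, ⟨y, hy⟩, ⟨m, hm⟩⟩ ⟨s', ⟨y', hy'⟩, ⟨m', hm'⟩⟩ h
      have h0 : y + m = y' + m' := congrArg Subtype.val h
      obtain ⟨h1, h2⟩ := hdisj y (hn1 s y hy) m hm.1.1 y' (hn1 s' y' hy') m' hm'.1.1 h0
      subst h1 h2
      have h3 : s = s' :=
        Subtype.ext ((hSrep y (hSmem s y hy)).unique ⟨s.2, hy⟩ ⟨s'.2, hy'⟩)
      subst h3
      rfl
    · rintro ⟨x, hx⟩
      have hx' : x - lam ∈ L := hx
      obtain ⟨x1, hx1, x2, hx2, rfl⟩ : ∃ x1 ∈ V₁, ∃ x2 ∈ V₂, x1 + x2 = x := by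
        have : x ∈ V₁ ⊔ V₂ := hcompl.sup_eq_top ▸ Submodule.mem_top
        exact Submodule.mem_sup.mp this
      have hxN : x1 ∈ Ndual := by
        rw [hNdual]
        refine ⟨hx1, fun l hl => ?_⟩
        obtain ⟨z, hz⟩ := hxint _ hx' l hl.1
        refine ⟨z, ?_⟩
        rw [map_add, LinearMap.add_apply, hsymm x2 l, horth l hl.2 x2 hx2, add_zero] at hz
        exact hz
      obtain ⟨s, ⟨hsS, hs⟩, -⟩ := hSrep x1 hxN
      refine ⟨⟨⟨s, hsS⟩, ⟨x1, hs⟩, ⟨x2, ⟨hx2, fun l hl => ?_⟩, ?_⟩⟩, rfl⟩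
      · obtain ⟨z, hz⟩ := hxint _ hx' l hl.1
        refine ⟨z, ?_⟩
        rw [map_add, LinearMap.add_apply, horth x1 hx1 l hl.2, zero_add] at hz
        exact hz
      · have h := L.sub_mem hx' hs.1
        have h2 : x1 + x2 - lam - (x1 - s) = x2 + s - lam := by abel
        rwa [h2] at h
  have hsumL : HasSum (fun x : {y : V | y - lam ∈ (L : Set V)} =>
        e (τ * ((B (prp (x : V)) (prp (x : V)) : ℝ) : ℂ) / 2
          + (starRingEnd ℂ) τ *
              ((B ((x : V) - prp (x : V)) ((x : V) - prp (x : V)) : ℝ) : ℂ) / 2))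
      (ThL lam τ) := by
    rw [hThL]
    exact (S1 τ hτ lam).of_norm.hasSum
  rw [← (Equiv.ofBijective φ hφ).hasSum_iff] at hsumL
  refine hsumL.sigma (g := fun ν : S => ThN (ν : V) τ * (starRingEnd ℂ) (vth (ν : V) τ)) ?_
  intro s
  have hA := S2 τ hτ (s : V)
  have hB := S3 τ hτ (s : V)
  have hB' : Summable (fun m : {m : V |
              (m ∈ V₂ ∧ ∀ x ∈ (L : Set V) ∩ (V₂ : Set V), ∃ z : ℤ, B m x = (z : ℝ))
                ∧ m + (s : V) - lam ∈ L} =>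
            ‖(starRingEnd ℂ) (e (-τ * ((B (m : V) (m : V) : ℝ) : ℂ) / 2))‖) := by
    simpa only [Complex.norm_conj] using hB
  have hN : HasSum (fun x : {y : V | y - (s : V) ∈ ((L : Set V) ∩ (V₁ : Set V))} =>
        e (τ * ((B (prp (x : V)) (prp (x : V)) : ℝ) : ℂ) / 2
          + (starRingEnd ℂ) τ *
              ((B ((x : V) - prp (x : V)) ((x : V) - prp (x : V)) : ℝ) : ℂ) / 2))
      (ThN s τ) := by
    rw [hThN]
    exact hA.of_norm.hasSum
  have hV : HasSum (fun m : {m : V |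
              (m ∈ V₂ ∧ ∀ x ∈ (L : Set V) ∩ (V₂ : Set V), ∃ z : ℤ, B m x = (z : ℝ))
                ∧ m + (s : V) - lam ∈ L} =>
            (starRingEnd ℂ) (e (-τ * ((B (m : V) (m : V) : ℝ) : ℂ) / 2)))
      ((starRingEnd ℂ) (vth s τ)) := by
    rw [hvth]
    exact hB.of_norm.hasSum.star
  have hm := hasSum_mul_aux _ _ _ _ hN hV hA hB'
  have hfun : ∀ y ∈ V₁, ∀ m ∈ V₂,
      e (τ * ((B (prp (y + m)) (prp (y + m)) : ℝ) : ℂ) / 2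
          + (starRingEnd ℂ) τ * ((B (y + m - prp (y + m)) (y + m - prp (y + m)) : ℝ) : ℂ) / 2)
      = e (τ * ((B (prp y) (prp y) : ℝ) : ℂ) / 2
          + (starRingEnd ℂ) τ * ((B (y - prp y) (y - prp y) : ℝ) : ℂ) / 2)
        * (starRingEnd ℂ) (e (-τ * ((B m m : ℝ) : ℂ) / 2)) := by
    intro y hy m hm
    have h1 : prp (y + m) = prp y := by
      rw [hprpp, hprpp, map_add, hV2 m hm, add_zero]
    have h2 : y + m - prp y = (y - prp y) + m := by abel
    have h3 : B (y - prp y) m = 0 :=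
      horth _ (V₁.sub_mem hy (hvpV₁ (hprpp y ▸ hpmem y))) _ hm
    have h4 : B (y + m - prp y) (y + m - prp y) = B (y - prp y) (y - prp y) + B m m := by
      rw [h2, map_add B, LinearMap.add_apply, map_add, map_add, hsymm m (y - prp y), h3]
      ring
    rw [h1, h4, conj_e, ← e_add]
    congr 1
    push_cast
    ring
  refine hasSum_congr_aux hm fun c => ?_
  exact hfun c.1.1 (hn1 s _ c.1.2) c.2.1 c.2.2.1.1
end
end
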